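/- arXiv:1907.02769 — 4 statements merged into one kernel-verified Lean document; each statement's English description precedes it below -/
import Mathlib

section
/- Let A = ∏ₙAₙ be a homogeneous Σ¹₁ set with each Aₙ either all of ℕ or finite, and let B = ∏ₙBₙ be a homogeneous Σ¹₁ set with each Bₙ cofinite. If A ≤_M B, then A contains a Δ¹₁ element, i.e., some f ∈ A whose graph is both Σ¹₁ and Π¹₁. -/
open Set

/-- Baire space. -/
abbrev Baire : Type := ℕ → ℕ

/-- The length-`n` initial segment of `x : Baire`, as a finite sequence. -/
def pre (x : Baire) (n : ℕ) : List ℕ := (List.range n).map x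

/-- A Turing functional, presented by a total computable monotone map on
finite sequences. -/
structure TuringFunctional where
  φ : List ℕ → List ℕ
  computable : Computable φ
  mono : ∀ σ τ : List ℕ, σ <+: τ → φ σ <+: φ τ

/-- `Φ` is defined on `x` with value `y`: every coordinate of `y` is eventually
output by `Φ` on initial segments of `x`. -/
def TuringFunctional.Eval (Φ : TuringFunctional) (x y : Baire) : Prop :=
  ∀ n, ∃ m, (Φ.φ (pre x m))[n]? = some (y n)

/-- Medvedev reducibility: some Turing functional is defined on every element
of `Q` and maps `Q` into `P`. -/
def MedvedevLE (P Q : Set Baire) : Prop :=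
  ∃ Φ : TuringFunctional, ∀ x ∈ Q, ∃ y ∈ P, Φ.Eval x y

/-- Strict Medvedev reducibility. -/
def MedvedevLT (P Q : Set Baire) : Prop := MedvedevLE P Q ∧ ¬ MedvedevLE Q P

/-- The homogeneous set `∏ₙ Aₙ`. -/
def homProd (A : ℕ → Set ℕ) : Set Baire := {x | ∀ n, x n ∈ A n}

/-- A family `(Aₙ)` of subsets of `ℕ` is uniformly `Σ¹₁`. -/
def UniformlySigma11 (A : ℕ → Set ℕ) : Prop :=
  ∃ R : ℕ × ℕ → List ℕ → Bool, Computable₂ R ∧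
    ∀ n m : ℕ, m ∈ A n ↔ ∃ y : Baire, ∀ k, R (n, m) (pre y k) = true

/-- A subset of Baire space is (lightface) `Σ¹₁`. -/
def Sigma11Set (S : Set Baire) : Prop :=
  ∃ R : List ℕ → List ℕ → Bool, Computable₂ R ∧
    ∀ x, x ∈ S ↔ ∃ y : Baire, ∀ m, R (pre x m) (pre y m) = true

/-- A set of finite sequences is (lightface) `Σ¹₁`. -/
def Sigma11List (T : Set (List ℕ)) : Prop :=
  ∃ R : List ℕ → List ℕ → Bool, Computable₂ R ∧
    ∀ σ, σ ∈ T ↔ ∃ y : Baire, ∀ m, R σ (pre y m) = true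

/-- A tree on `ℕ`: a set of finite sequences closed under prefixes. -/
def IsTree (T : Set (List ℕ)) : Prop := ∀ σ ∈ T, ∀ τ : List ℕ, τ <+: σ → τ ∈ T

/-- The set `[T]` of infinite paths through `T`. -/
def paths (T : Set (List ℕ)) : Set Baire := {x | ∀ n, pre x n ∈ T}

/-- A subset of `ℕ × ℕ` is (lightface) `Σ¹₁`. -/
def Sigma11Pairs (A : Set (ℕ × ℕ)) : Prop :=
  ∃ R : ℕ × ℕ → List ℕ → Bool, Computable₂ R ∧
    ∀ p : ℕ × ℕ, p ∈ A ↔ ∃ y : Baire, ∀ k, R p (pre y k) = true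

/-- A function `f : ℕ → ℕ` is `Δ¹₁`: its graph is both `Σ¹₁` and `Π¹₁`. -/
def Delta11Fun (f : ℕ → ℕ) : Prop :=
  Sigma11Pairs {p : ℕ × ℕ | f p.1 = p.2} ∧ Sigma11Pairs {p : ℕ × ℕ | f p.1 ≠ p.2}

/-- One-step extension between nodes of `T`; nodes are stored in reverse, newest entry first. -/
def Child (T : List ℕ → Prop) (ρ' ρ : List ℕ) : Prop := T ρ' ∧ ∃ v, ρ' = v :: ρ

/-- The rank of `ρ` in `T` is at most the rank of `σ` in `S`, ill-founded nodes having rank `∞`. -/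
def RankLE (T S : List ℕ → Prop) (ρ σ : List ℕ) : Prop :=
  ∀ hσ : Acc (Child S) σ, ∃ hρ : Acc (Child T) ρ, hρ.rank ≤ hσ.rank

/-- The image of a node under the length-preserving map that appends `y ρ` on reaching `ρ`,
started at `b`. -/
def trace (y : List ℕ → ℕ) (b : List ℕ) : List ℕ → List ℕ
  | [] => b
  | v :: ρ => y (v :: ρ) :: trace y b ρ

section Trees

variable {T S : List ℕ → Prop}

theorem exists_child_rankLE_of_lt {τ σ : List ℕ}
    (h : ∀ hσ : Acc (Child S) σ, ∃ hτ : Acc (Child T) τ, hτ.rank < hσ.rank) :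
    ∃ w, S (w :: σ) ∧ RankLE T S τ (w :: σ) := by
  by_cases hσ : Acc (Child S) σ
  · obtain ⟨hτ, hlt⟩ := h hσ
    rw [hσ.rank_eq, Ordinal.lt_iSup_iff] at hlt
    obtain ⟨⟨_, hS, w, rfl⟩, hlt⟩ := hlt
    exact ⟨w, hS, fun _ => ⟨hτ, Order.lt_succ_iff.1 hlt⟩⟩
  · obtain ⟨_, hb, hS, w, rfl⟩ := exists_not_acc_lt_of_not_acc hσ
    exact ⟨w, hS, fun h => absurd h hb⟩

theorem RankLE.exists_child {τ σ : List ℕ} {v : ℕ} (h : RankLE T S τ σ) (hv : T (v :: τ)) :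
    ∃ w, S (w :: σ) ∧ RankLE T S (v :: τ) (w :: σ) := by
  refine exists_child_rankLE_of_lt fun hσ => ?_
  obtain ⟨hτ, hle⟩ := h hσ
  exact ⟨hτ.inv ⟨hv, v, rfl⟩, (hτ.rank_lt_of_rel ⟨hv, v, rfl⟩).trans_le hle⟩

theorem RankLE.exists_trace (hT : ∀ v ρ, T (v :: ρ) → T ρ) {b : List ℕ} (hb : S b)
    (h : RankLE T S [] b) : ∃ y, ∀ ρ, T ρ → S (trace y b ρ) := by
  have step : ∀ ρ σ v, ∃ w, RankLE T S ρ σ → T (v :: ρ) →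
      S (w :: σ) ∧ RankLE T S (v :: ρ) (w :: σ) := by
    intro ρ σ v
    by_cases h : RankLE T S ρ σ ∧ T (v :: ρ)
    · obtain ⟨w, hw⟩ := h.1.exists_child h.2
      exact ⟨w, fun _ _ => hw⟩
    · exact ⟨0, fun h₁ h₂ => absurd ⟨h₁, h₂⟩ h⟩
  choose w hw using step
  let H : List ℕ → List ℕ := fun ρ => List.rec b (fun v ρ' ih => w ρ' ih v :: ih) ρ
  have hH : ∀ ρ, trace (fun ρ => (H ρ).headD 0) b ρ = H ρ := by
    intro ρ
    induction ρ with
    | nil => rfl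
    | cons v ρ ih => rw [trace, ih]; rfl
  refine ⟨fun ρ => (H ρ).headD 0, fun ρ hρ => ?_⟩
  rw [hH]
  suffices S (H ρ) ∧ RankLE T S ρ (H ρ) from this.1
  induction ρ with
  | nil => exact ⟨hb, h⟩
  | cons v ρ ih => exact hw ρ (H ρ) v (ih (hT v ρ hρ)).2 hρ

theorem rankLE_of_trace {y : List ℕ → ℕ} {b : List ℕ} (h : ∀ ρ, T ρ → S (trace y b ρ)) :
    RankLE T S [] b := by
  suffices ∀ σ, Acc (Child S) σ → ∀ ρ, trace y b ρ = σ → RankLE T S ρ σ from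
    fun hb => this b hb [] rfl hb
  intro σ hσ
  induction hσ with
  | intro σ _ ih =>
    rintro ρ rfl hσ
    have key : ∀ ρ', Child T ρ' ρ → Child S (trace y b ρ') (trace y b ρ) := by
      rintro _ ⟨hT, v, rfl⟩
      exact ⟨h _ hT, _, rfl⟩
    have hρ : Acc (Child T) ρ :=
      ⟨_, fun ρ' hρ' => (ih _ (key ρ' hρ') ρ' rfl (hσ.inv (key ρ' hρ'))).1⟩
    refine ⟨hρ, ?_⟩
    rw [hρ.rank_eq, Ordinal.iSup_le_iff]
    rintro ⟨ρ', hρ'⟩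
    obtain ⟨_, hle⟩ := ih _ (key ρ' hρ') ρ' rfl (hσ.inv (key ρ' hρ'))
    exact Order.succ_le_of_lt (hle.trans_lt (hσ.rank_lt_of_rel (key ρ' hρ')))

theorem pre_succ_reverse (x : Baire) (m : ℕ) :
    (pre x (m + 1)).reverse = x m :: (pre x m).reverse := by
  simp [pre, List.range_succ]

theorem not_acc_nil_iff_exists_path (h0 : T []) :
    ¬ Acc (Child T) [] ↔ ∃ x : Baire, ∀ m, T (pre x m).reverse := by
  rw [not_acc_iff_exists_descending_chain]
  constructor
  · rintro ⟨f, hf0, hf⟩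
    have hx : ∀ m, (pre (fun i => (f (i + 1)).headD 0) m).reverse = f m := by
      intro m
      induction m with
      | zero => exact hf0.symm
      | succ m ih =>
        obtain ⟨v, hv⟩ := (hf m).2
        rw [pre_succ_reverse, ih, hv]
        simp
    refine ⟨fun i => (f (i + 1)).headD 0, fun m => ?_⟩
    rw [hx]
    cases m with
    | zero => rwa [hf0]
    | succ m => exact (hf m).1
  · rintro ⟨x, hx⟩
    exact ⟨fun m => (pre x m).reverse, rfl, fun m => ⟨hx (m + 1), x m, pre_succ_reverse x m⟩⟩

end Trees

/-- `k` is the least index of a tree of minimal rank in the family `T`, as witnessed by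
maps of `T k` into the other trees, strictly below the root for smaller indices. -/
def IsSelected (T : ℕ → List ℕ → Prop) (k : ℕ) (y : ℕ → List ℕ → ℕ) : Prop :=
  ∀ j, j ≠ k → ∀ ρ, T k ρ → T j (trace (y j) (if j < k then [y j []] else []) ρ)

section Selection

variable {T : ℕ → List ℕ → Prop}

theorem IsSelected.acc {k : ℕ} {y : ℕ → List ℕ → ℕ} (h : IsSelected T k y)
    (hacc : ∃ j, Acc (Child (T j)) []) (h0 : ∀ j, T j []) : Acc (Child (T k)) [] := by
  obtain ⟨j, hj⟩ := hacc
  obtain rfl | hjk := eq_or_ne j k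
  · exact hj
  have := rankLE_of_trace (h j hjk)
  split_ifs at this with hlt
  · have hw := h j hjk [] (h0 k)
    rw [if_pos hlt] at hw
    exact (this (hj.inv ⟨hw, _, rfl⟩)).1
  · exact (this hj).1

theorem IsSelected.eq {k k' : ℕ} {y y' : ℕ → List ℕ → ℕ} (h : IsSelected T k y)
    (h' : IsSelected T k' y') (hacc : ∃ j, Acc (Child (T j)) []) (h0 : ∀ j, T j []) :
    k = k' := by
  wlog hlt : k < k' generalizing k k' y y'
  · rcases lt_trichotomy k k' with hk | hk | hk
    exacts [absurd hk hlt, hk, (this h' h hk).symm]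
  exfalso
  have hk := h.acc hacc h0
  have hk' := h'.acc hacc h0
  have h₁ := rankLE_of_trace (h k' hlt.ne')
  rw [if_neg hlt.le.not_gt] at h₁
  have h₂ := rankLE_of_trace (h' k hlt.ne)
  have hw := h' k hlt.ne [] (h0 k')
  rw [if_pos hlt] at h₂ hw
  have hc : Child (T k) [y' k []] [] := ⟨hw, _, rfl⟩
  obtain ⟨_, h₁⟩ := h₁ hk'
  obtain ⟨_, h₂⟩ := h₂ (hk.inv hc)
  exact ((h₂.trans_lt (hk.rank_lt_of_rel hc)).trans_le h₁).false

theorem exists_isSelected (hT : ∀ j v ρ, T j (v :: ρ) → T j ρ)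
    (hacc : ∃ j, Acc (Child (T j)) []) (h0 : ∀ j, T j []) : ∃ k y, IsSelected T k y := by
  classical
  obtain ⟨⟨j₀, hj₀⟩, -, hmin⟩ := WellFounded.has_min
    (InvImage.wf (fun j : {j // Acc (Child (T j)) []} => j.2.rank) Ordinal.lt_wf) Set.univ
    ⟨⟨_, hacc.choose_spec⟩, trivial⟩
  have hex : ∃ k, ∃ hk : Acc (Child (T k)) [], hk.rank = hj₀.rank := ⟨j₀, hj₀, rfl⟩
  obtain ⟨hk, hrank⟩ := Nat.find_spec hex
  set k := Nat.find hex
  have hle : ∀ j (hj : Acc (Child (T j)) []), hk.rank ≤ hj.rank := fun j hj =>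
    hrank.trans_le (not_lt.1 (hmin ⟨j, hj⟩ trivial))
  have : ∀ j, ∃ y : List ℕ → ℕ,
      ∀ ρ, T k ρ → T j (trace y (if j < k then [y []] else []) ρ) := by
    intro j
    split_ifs with hlt
    · obtain ⟨w, hw, hr⟩ : ∃ w, T j [w] ∧ RankLE (T k) (T j) [] [w] := by
        refine exists_child_rankLE_of_lt fun hj => ⟨hk, (hle j hj).lt_of_ne fun he => ?_⟩
        exact Nat.find_min hex hlt ⟨hj, he ▸ hrank⟩
      obtain ⟨y, hy⟩ := hr.exists_trace (hT k) hw
      have htr : ∀ ρ, trace (Function.update y [] w) [w] ρ = trace y [w] ρ := by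
        intro ρ
        induction ρ with
        | nil => rfl
        | cons v ρ ih => simp [trace, ih]
      refine ⟨Function.update y [] w, fun ρ hρ => ?_⟩
      rw [Function.update_self, htr]
      exact hy ρ hρ
    · exact RankLE.exists_trace (hT k) (h0 j) fun hj => ⟨hk, hle j hj⟩
  choose y hy using this
  exact ⟨k, y, fun j _ => hy j⟩

end Selection

theorem getD_pre (x : Baire) {m i : ℕ} (h : i < m) : (pre x m).getD i 0 = x i := by
  simp [pre, List.getD_eq_getElem?_getD, h]

theorem length_pre (x : Baire) (m : ℕ) : (pre x m).length = m := by
  simp [pre]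

section Closed

variable {α : Type*} [Primcodable α]

theorem computable_decide_forall_lt {f : α → ℕ} {p : α → ℕ → Bool} (hf : Computable f)
    (hp : Computable₂ p) : Computable fun a => decide (∀ i < f a, p a i = true) := by
  have h : Computable fun a =>
      ((f a).rec true fun i (ih : Bool) => ih && p a i : Bool) := by
    refine Computable.nat_rec (h := fun a q => q.2 && p a q.1) hf (Computable.const true) ?_
    exact (Primrec.and.to_comp.comp (Computable.snd.comp Computable.snd)
      (hp.comp Computable.fst (Computable.fst.comp Computable.snd)) :)
  refine h.of_eq fun a => ?_
  induction f a with
  | zero => simp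
  | succ n ih =>
    rw [Bool.eq_iff_iff]
    change (_ && p a n) = true ↔ _
    rw [ih, Bool.and_eq_true, decide_eq_true_eq, decide_eq_true_eq]
    exact Nat.forall_lt_succ_right.symm

/-- A predicate `∃ y, ∀ m, V (y↾F m)` testing `y` at finitely many places `F a m` for each `m`
can be expressed through the initial segments of `y`. -/
theorem exists_computable_forall_pre {F : α → ℕ → List ℕ} {V : α → ℕ → List ℕ → Bool}
    (hF : Computable₂ F) (hV : Computable fun q : (α × ℕ) × List ℕ => V q.1.1 q.1.2 q.2) :
    ∃ R : α → List ℕ → Bool, Computable₂ R ∧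
      ∀ a (y : Baire), (∀ k, R a (pre y k) = true) ↔ ∀ m, V a m ((F a m).map y) = true := by
  let R : α → List ℕ → Bool := fun a τ =>
    !((F a τ.length.unpair.1).all fun i => decide (i < τ.length)) ||
      V a τ.length.unpair.1 ((F a τ.length.unpair.1).map fun i => τ.getD i 0)
  refine ⟨R, ?_, fun a y => ?_⟩
  · have hlen : Computable fun q : α × List ℕ => q.2.length.unpair.1 :=
      Computable.fst.comp (Computable.unpair.comp (Computable.list_length.comp Computable.snd))
    have hF' : Computable fun q : α × List ℕ => F q.1 q.2.length.unpair.1 :=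
      hF.comp Computable.fst hlen
    have hall : Primrec fun q : List ℕ × List ℕ => q.1.all fun i => decide (i < q.2.length) := by
      have : PrimrecRel fun (L τ : List ℕ) => ∀ i ∈ L, i < τ.length :=
        PrimrecRel.forall_mem_list (R := fun (i : ℕ) (τ : List ℕ) => i < τ.length)
          (Primrec.nat_lt.comp Primrec.fst (Primrec.list_length.comp Primrec.snd))
      exact Primrec.of_eq this.decide fun q => by rw [Bool.eq_iff_iff]; simp
    have hmap : Primrec fun q : List ℕ × List ℕ => q.1.map fun i => q.2.getD i 0 :=
      Primrec.list_map Primrec.fst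
        ((Primrec.list_getD 0).comp (Primrec.snd.comp Primrec.fst) Primrec.snd)
    have h₁ := hall.to_comp.comp (hF'.pair Computable.snd)
    have h₂ := hV.comp ((Computable.fst.pair hlen).pair
      (hmap.to_comp.comp (hF'.pair Computable.snd)))
    exact Primrec.or.to_comp.comp (Primrec.not.to_comp.comp h₁) h₂
  · have hR : ∀ k, R a (pre y k) = true ↔ ((∀ i ∈ F a k.unpair.1, i < k) →
        V a k.unpair.1 ((F a k.unpair.1).map y) = true) := by
      intro k
      simp only [R, length_pre, Bool.or_eq_true, Bool.not_eq_true', ← Bool.not_eq_true,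
        List.all_eq_true, decide_eq_true_eq, ← imp_iff_not_or]
      refine imp_congr_right fun h => ?_
      rw [List.map_congr_left fun i hi => getD_pre y (h i hi)]
    simp only [hR]
    refine ⟨fun h m => ?_, fun h k _ => h _⟩
    have := h (Nat.pair m ((F a m).sum + 1))
    rw [Nat.unpair_pair] at this
    exact this fun i hi => (Nat.lt_succ_of_le (List.le_sum_of_mem hi)).trans_le
      (Nat.right_le_pair _ _)

end Closed

section Avoidance

/-- The value `o` is not the one coded by `k`: the code `j + 1` stands for the number `j`, and the
code `0` for all numbers that are at least `N`. -/
def avoids (k N : ℕ) (o : Option ℕ) : Bool :=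
  o.elim true fun v => bif k == 0 then decide (v < N) else !(v + 1 == k)

/-- `y` witnesses that every sequence bounding `y` pointwise avoids the value coded by `k` at the
`n`th coordinate of the functional. -/
def Avoids (φ : List ℕ → List ℕ) (n k : ℕ) (y : Baire) : Prop :=
  ∀ σ : List ℕ, (∀ i < σ.length, y i ≤ σ.getD i 0) → avoids k (y 0) (φ σ)[n]? = true

/-- The tree of attempts to build a sequence `y` with `Avoids φ n k y`. -/
def avoidTree (φ : List ℕ → List ℕ) (p : ℕ × ℕ) (τ : List ℕ) : Bool :=
  decide (∀ c < τ.length, ((!decide ((Denumerable.ofNat (List ℕ) c).length ≤ τ.length)) ||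
    (!decide (∀ i < (Denumerable.ofNat (List ℕ) c).length,
      decide (τ.getD i 0 ≤ (Denumerable.ofNat (List ℕ) c).getD i 0) = true)) ||
    avoids p.2 (τ.getD 0 0) (φ (Denumerable.ofNat (List ℕ) c))[p.1]?) = true)

variable {φ : List ℕ → List ℕ}

theorem avoidTree_eq_true {p : ℕ × ℕ} {τ : List ℕ} : avoidTree φ p τ = true ↔
    ∀ σ : List ℕ, Encodable.encode σ < τ.length → σ.length ≤ τ.length →
      (∀ i < σ.length, τ.getD i 0 ≤ σ.getD i 0) →
        avoids p.2 (τ.getD 0 0) (φ σ)[p.1]? = true := by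
  simp only [avoidTree, decide_eq_true_eq, Bool.or_eq_true, Bool.not_eq_true',
    decide_eq_false_iff_not]
  constructor
  · intro h σ hc hl hd
    have := h _ hc
    rw [Denumerable.ofNat_encode] at this
    tauto
  · intro h c hc
    have := h (Denumerable.ofNat (List ℕ) c) (by rwa [Denumerable.encode_ofNat])
    tauto

theorem computable_avoidTree (hφ : Computable φ) : Computable₂ (avoidTree φ) := by
  refine computable_decide_forall_lt (α := (ℕ × ℕ) × List ℕ)
    (p := fun a c => (!decide ((Denumerable.ofNat (List ℕ) c).length ≤ a.2.length)) ||
      (!decide (∀ i < (Denumerable.ofNat (List ℕ) c).length,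
        decide (a.2.getD i 0 ≤ (Denumerable.ofNat (List ℕ) c).getD i 0) = true)) ||
      avoids a.1.2 (a.2.getD 0 0) (φ (Denumerable.ofNat (List ℕ) c))[a.1.1]?)
    (Computable.list_length.comp Computable.snd) ?_
  have hσ : Primrec fun q : ((ℕ × ℕ) × List ℕ) × ℕ => Denumerable.ofNat (List ℕ) q.2 :=
    (Primrec.ofNat _).comp Primrec.snd
  have hτ : Primrec fun q : ((ℕ × ℕ) × List ℕ) × ℕ => q.1.2 := Primrec.snd.comp Primrec.fst
  have h₁ := (Primrec.nat_le.comp (Primrec.list_length.comp hσ)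
    (Primrec.list_length.comp hτ)).decide.to_comp
  have hle : Primrec fun r : (((ℕ × ℕ) × List ℕ) × ℕ) × ℕ =>
      decide (r.1.1.2.getD r.2 0 ≤ (Denumerable.ofNat (List ℕ) r.1.2).getD r.2 0) :=
    (Primrec.nat_le.comp ((Primrec.list_getD 0).comp (hτ.comp Primrec.fst) Primrec.snd)
      ((Primrec.list_getD 0).comp (hσ.comp Primrec.fst) Primrec.snd)).decide
  have h₂ := computable_decide_forall_lt (Primrec.list_length.comp hσ).to_comp
    hle.to_comp.to₂
  have havoids : Primrec fun q : (ℕ × ℕ) × Option ℕ => avoids q.1.1 q.1.2 q.2 := by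
    have : Primrec₂ fun (q : (ℕ × ℕ) × Option ℕ) (v : ℕ) =>
        bif q.1.1 == 0 then decide (v < q.1.2) else !(v + 1 == q.1.1) := by
      have hk : Primrec fun r : ((ℕ × ℕ) × Option ℕ) × ℕ => r.1.1.1 :=
        Primrec.fst.comp (Primrec.fst.comp Primrec.fst)
      exact Primrec.cond (Primrec.beq.comp hk (Primrec.const 0))
        (Primrec.nat_lt.comp Primrec.snd
          (Primrec.snd.comp (Primrec.fst.comp Primrec.fst))).decide
        (Primrec.not.comp (Primrec.beq.comp (Primrec.succ.comp Primrec.snd) hk))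
    exact (Primrec.option_casesOn Primrec.snd (Primrec.const true) this).of_eq fun q => by
      obtain ⟨_, _ | _⟩ := q <;> rfl
  have h₃ := havoids.to_comp.comp (((Computable.snd.comp (Computable.fst.comp Computable.fst)).pair
    ((Primrec.list_getD 0).comp hτ (Primrec.const 0)).to_comp).pair
      (Computable.list_getElem?.comp (hφ.comp hσ.to_comp)
        (Computable.fst.comp (Computable.fst.comp Computable.fst))))
  exact (Primrec.or.to_comp.comp (Primrec.or.to_comp.comp (Primrec.not.to_comp.comp h₁)
    (Primrec.not.to_comp.comp h₂)) h₃ :)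

theorem avoidTree_of_append {p : ℕ × ℕ} {τ τ' : List ℕ}
    (h : avoidTree φ p (τ ++ τ') = true) : avoidTree φ p τ = true := by
  rw [avoidTree_eq_true] at h ⊢
  intro σ hc hl hd
  have key : ∀ i < τ.length, (τ ++ τ').getD i 0 = τ.getD i 0 := fun i hi =>
    List.getD_append _ _ _ _ hi
  rw [← key 0 (by omega)]
  refine h σ (by simp; omega) (by simp; omega) fun i hi => ?_
  rw [key i (by omega)]
  exact hd i hi

theorem forall_avoidTree_pre {n k : ℕ} {y : Baire} :
    (∀ m, avoidTree φ (n, k) (pre y m) = true) ↔ Avoids φ n k y := by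
  simp only [avoidTree_eq_true, length_pre]
  constructor
  · intro h σ hσ
    have := h (max (Encodable.encode σ + 1) σ.length) σ (by simp) (le_max_right _ _)
    rw [getD_pre y (by simp)] at this
    refine this fun i hi => ?_
    rw [getD_pre y (by simp [hi])]
    exact hσ i hi
  · intro h m σ hc hl hd
    rw [getD_pre y (by omega)]
    refine h σ fun i hi => ?_
    rw [← getD_pre y (hi.trans_le hl)]
    exact hd i hi

variable {A B : ℕ → Set ℕ}

theorem mem_of_extends {Φ : TuringFunctional}
    (hΦ : ∀ x ∈ homProd B, ∃ y ∈ homProd A, Φ.Eval x y) (hne : ∀ i, (B i).Nonempty)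
    {σ : List ℕ} (hσ : ∀ i < σ.length, σ.getD i 0 ∈ B i) {n v : ℕ}
    (hv : (Φ.φ σ)[n]? = some v) : v ∈ A n := by
  let x : Baire := fun i => if i < σ.length then σ.getD i 0 else (hne i).some
  have hx : x ∈ homProd B := by
    intro i
    by_cases hi : i < σ.length
    · simpa only [x, if_pos hi] using hσ i hi
    · simpa only [x, if_neg hi] using (hne i).some_mem
  have hσx : pre x σ.length = σ := by
    refine List.ext_getElem (length_pre _ _) fun i h₁ h₂ => ?_
    simp [pre, x, h₂]
  obtain ⟨z, hzA, hz⟩ := hΦ x hx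
  obtain ⟨m, hm⟩ := hz n
  have hpre : ∀ {i j}, i ≤ j → Φ.φ (pre x i) <+: Φ.φ (pre x j) := fun h =>
    Φ.mono _ _ ((List.prefix_iff_eq_take.2 (by simp [List.take_range, h])).map x)
  have hlift : ∀ {l l' : List ℕ} {v : ℕ}, l <+: l' → l[n]? = some v → l'[n]? = some v := by
    rintro l _ v ⟨t, rfl⟩ h
    rw [List.getElem?_append_left (List.getElem?_eq_some_iff.1 h).1, h]
  rw [← hσx] at hv
  have h₁ := hlift (hpre (le_max_left σ.length m)) hv
  have h₂ := hlift (hpre (le_max_right σ.length m)) hm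
  rw [h₁, Option.some_inj] at h₂
  exact h₂ ▸ hzA n

theorem exists_bound (hB : ∀ n, (B n)ᶜ.Finite) : ∃ b : Baire, ∀ n v, b n ≤ v → v ∈ B n := by
  have : ∀ n, ∃ b, ∀ v, b ≤ v → v ∈ B n := by
    intro n
    obtain ⟨b, hb⟩ := (hB n).bddAbove
    refine ⟨b + 1, fun v hv => ?_⟩
    by_contra hn
    have := hb hn
    omega
  choose b hb using this
  exact ⟨b, hb⟩

theorem Avoids.exists_not {Φ : TuringFunctional}
    (hΦ : ∀ x ∈ homProd B, ∃ y ∈ homProd A, Φ.Eval x y) {b : Baire}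
    (hb : ∀ n v, b n ≤ v → v ∈ B n) (n : ℕ) : ∃ k, ∀ y, ¬ Avoids Φ.φ n k y := by
  by_contra! h
  choose y hy using h
  let N := y 0 0
  let x : Baire := fun i => max (b i) ((Finset.range (N + 1)).sup fun k => y k i)
  have hx : x ∈ homProd B := fun i => hb i _ (le_max_left _ _)
  obtain ⟨z, -, hz⟩ := hΦ x hx
  obtain ⟨m, hm⟩ := hz n
  have key : ∀ k ≤ N, avoids k (y k 0) (some (z n)) = true := by
    intro k hk
    rw [← hm]
    refine hy k _ fun i hi => ?_
    rw [length_pre] at hi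
    rw [getD_pre x hi]
    exact le_max_of_le_right (Finset.le_sup (f := fun k => y k i) (by simp; omega))
  have h0 := key 0 (Nat.zero_le _)
  simp only [avoids, Option.elim] at h0
  simp only [beq_self_eq_true, cond_true, decide_eq_true_eq] at h0
  have h1 := key (z n + 1) h0
  simp [avoids] at h1

theorem pred_mem_of_forall_not_avoids {Φ : TuringFunctional}
    (hΦ : ∀ x ∈ homProd B, ∃ y ∈ homProd A, Φ.Eval x y) {b : Baire}
    (hb : ∀ n v, b n ≤ v → v ∈ B n) {n k : ℕ} (hA : A n = Set.univ ∨ (A n).Finite)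
    (hk : ∀ y, ¬ Avoids Φ.φ n k y) : k - 1 ∈ A n := by
  have key : ∀ N, ∃ v ∈ A n, avoids k (max (b 0) N) (some v) = false := by
    intro N
    have := hk (fun i => if i = 0 then max (b 0) N else b i)
    simp only [Avoids, not_forall] at this
    obtain ⟨σ, hσ, hav⟩ := this
    cases hv : (Φ.φ σ)[n]? with
    | none => simp [hv, avoids] at hav
    | some v =>
      rw [hv, if_pos trivial, Bool.not_eq_true] at hav
      refine ⟨v, mem_of_extends hΦ (fun i => ⟨b i, hb i _ le_rfl⟩) (fun i hi => hb i _ ?_) hv, hav⟩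
      refine le_trans ?_ (hσ i hi)
      split_ifs with h
      · subst h; exact le_max_left _ _
      · exact le_rfl
  cases k with
  | zero =>
    obtain hA | hA := hA
    · simp [hA]
    obtain ⟨M, hM⟩ := hA.bddAbove
    obtain ⟨v, hv, h⟩ := key (M + 1)
    have := hM hv
    simp [avoids] at h
    omega
  | succ j =>
    obtain ⟨v, hv, h⟩ := key 0
    simp [avoids] at h
    subst h
    simpa using hv

end Avoidance

section Definability

theorem trace_eq_append (y : List ℕ → ℕ) (b ρ : List ℕ) :
    trace y b ρ = (List.range ρ.length).map (fun i => y (ρ.drop i)) ++ b := by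
  induction ρ with
  | nil => rfl
  | cons v ρ ih => simp [trace, ih, List.range_succ_eq_map, Function.comp_def]

theorem trace_eq_take (y : List ℕ → ℕ) (j k : ℕ) (ρ : List ℕ) :
    trace y (if j < k then [y []] else []) ρ =
      ((List.range (ρ.length + 1)).map fun i => y (ρ.drop i)).take
        (ρ.length + bif decide (j < k) then 1 else 0) := by
  rw [trace_eq_append]
  by_cases h : j < k <;> simp [h, List.range_succ]

theorem exists_sigma11_selected {T : ℕ × ℕ → List ℕ → Bool} (hT : Computable₂ T)
    {D : ℕ × ℕ → ℕ → Bool} (hD : Computable₂ D) :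
    ∃ R : ℕ × ℕ → List ℕ → Bool, Computable₂ R ∧ ∀ p : ℕ × ℕ,
      (∃ k, D p k = true ∧ ∃ y, IsSelected (fun j ρ => T (p.1, j) ρ.reverse = true) k y) ↔
        ∃ z : Baire, ∀ m, R p (pre z m) = true := by
  let node : ℕ → ℕ × List ℕ := Denumerable.ofNat (ℕ × List ℕ)
  let F : ℕ × ℕ → ℕ → List ℕ := fun _ c =>
    0 :: (List.range ((node c).2.length + 1)).map fun i =>
      Encodable.encode ((node c).1, (node c).2.drop i) + 1
  let V : ℕ × ℕ → ℕ → List ℕ → Bool := fun p c vs =>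
    D p vs.headI && ((node c).1 == vs.headI || (!T (p.1, vs.headI) (node c).2.reverse ||
      T (p.1, (node c).1) (vs.tail.take
        ((node c).2.length + bif decide ((node c).1 < vs.headI) then 1 else 0)).reverse))
  have hnode : Primrec node := Primrec.ofNat _
  have hF : Computable₂ F := by
    have hc : Primrec fun q : (ℕ × ℕ) × ℕ => node q.2 := hnode.comp Primrec.snd
    have hc' : Primrec fun q : ((ℕ × ℕ) × ℕ) × ℕ => node q.1.2 := hc.comp Primrec.fst
    refine Primrec.to_comp (Primrec.list_cons.comp (Primrec.const 0) (Primrec.list_map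
      (Primrec.list_range.comp (Primrec.succ.comp
        (Primrec.list_length.comp (Primrec.snd.comp hc)))) ?_))
    exact Primrec.succ.comp (Primrec.encode.comp ((Primrec.fst.comp hc').pair
      (Primrec.list_drop.comp Primrec.snd (Primrec.snd.comp hc'))))
  have hV : Computable fun q : ((ℕ × ℕ) × ℕ) × List ℕ => V q.1.1 q.1.2 q.2 := by
    have hc : Primrec fun q : ((ℕ × ℕ) × ℕ) × List ℕ => node q.1.2 :=
      hnode.comp (Primrec.snd.comp Primrec.fst)
    have hk : Primrec fun q : ((ℕ × ℕ) × ℕ) × List ℕ => q.2.headI :=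
      Primrec.list_headI.comp Primrec.snd
    have hn : Primrec fun q : ((ℕ × ℕ) × ℕ) × List ℕ => q.1.1.1 :=
      Primrec.fst.comp (Primrec.fst.comp Primrec.fst)
    have hj := Primrec.fst.comp hc
    have htake := Primrec.list_reverse.comp (Primrec.list_take.comp
      (Primrec.nat_add.comp (Primrec.list_length.comp (Primrec.snd.comp hc))
        (Primrec.cond (Primrec.nat_lt.comp hj hk).decide (Primrec.const 1) (Primrec.const 0)))
      (Primrec.list_tail.comp Primrec.snd))
    have h₁ := hD.comp (Computable.fst.comp Computable.fst) hk.to_comp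
    have h₂ := (Primrec.beq.comp hj hk).to_comp
    have h₃ := Primrec.not.to_comp.comp (hT.comp (hn.pair hk).to_comp
      (Primrec.list_reverse.comp (Primrec.snd.comp hc)).to_comp)
    have h₄ := hT.comp (hn.pair hj).to_comp htake.to_comp
    exact (Primrec.and.to_comp.comp h₁ (Primrec.or.to_comp.comp h₂
      (Primrec.or.to_comp.comp h₃ h₄)) :)
  obtain ⟨R, hR, hiff⟩ := exists_computable_forall_pre hF hV
  refine ⟨R, hR, fun p => ?_⟩
  have key : ∀ z : Baire, (∀ m, R p (pre z m) = true) ↔ D p (z 0) = true ∧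
      IsSelected (fun j ρ => T (p.1, j) ρ.reverse = true) (z 0)
        fun j ρ => z (Encodable.encode (j, ρ) + 1) := by
    intro z
    have hVz : ∀ c, V p c ((F p c).map z) = true ↔ D p (z 0) = true ∧
        ((node c).1 ≠ z 0 → T (p.1, z 0) (node c).2.reverse = true →
          T (p.1, (node c).1) (trace (fun ρ => z (Encodable.encode ((node c).1, ρ) + 1))
            (if (node c).1 < z 0 then [z (Encodable.encode ((node c).1, ([] : List ℕ)) + 1)]
              else []) (node c).2).reverse = true) := by
      intro c
      rw [trace_eq_take (fun ρ => z (Encodable.encode ((node c).1, ρ) + 1))]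
      simp only [V, F, List.map_cons, List.headI_cons, List.tail_cons, List.map_map,
        Function.comp_def, Bool.and_eq_true, Bool.or_eq_true, beq_iff_eq, Bool.not_eq_true',
        ← Bool.not_eq_true, or_iff_not_imp_left, ne_eq, not_not]
      exact Iff.rfl
    rw [hiff]
    simp only [hVz]
    constructor
    · intro h
      refine ⟨(h 0).1, fun j hj ρ hρ => ?_⟩
      have := (h (Encodable.encode (j, ρ))).2
      simp only [node, Denumerable.ofNat_encode] at this
      exact this hj hρ
    · exact fun h c => ⟨h.1, fun hj hρ => h.2 _ hj _ hρ⟩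
  simp only [key]
  constructor
  · rintro ⟨k, hk, y, hy⟩
    refine ⟨fun m => Nat.casesOn m k fun c => y (node c).1 (node c).2, hk, ?_⟩
    simpa [node] using hy
  · rintro ⟨z, hz, hs⟩
    exact ⟨_, hz, _, hs⟩

end Definability

/-- If an all-or-finite homogeneous `Σ¹₁` set is Medvedev reducible to a
homogeneous `Σ¹₁` set with cofinite factors, then it has a `Δ¹₁` element. -/
theorem delta11_member_of_aof_le_cofinite :
    ∀ A B : ℕ → Set ℕ, UniformlySigma11 A → UniformlySigma11 B →
      (∀ n, A n = Set.univ ∨ (A n).Finite) → (∀ n, (B n)ᶜ.Finite) →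
      MedvedevLE (homProd A) (homProd B) →
      ∃ f : ℕ → ℕ, f ∈ homProd A ∧ Delta11Fun f := by
  rintro A B - - hA hB ⟨Φ, hΦ⟩
  obtain ⟨b, hb⟩ := exists_bound hB
  let T : ℕ → ℕ → List ℕ → Prop := fun n j ρ => avoidTree Φ.φ (n, j) ρ.reverse = true
  have h0 : ∀ n j, T n j [] := fun n j => by simp [T, avoidTree]
  have hT : ∀ n j v ρ, T n j (v :: ρ) → T n j ρ := fun n j v ρ h =>
    avoidTree_of_append (τ' := [v]) (by simpa [T] using h)
  have hiff : ∀ n j, Acc (Child (T n j)) [] ↔ ∀ y, ¬ Avoids Φ.φ n j y := fun n j => by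
    rw [← not_iff_not, not_acc_nil_iff_exists_path (h0 n j)]
    simp only [T, List.reverse_reverse, forall_avoidTree_pre, not_forall, not_not]
  have hacc : ∀ n, ∃ j, Acc (Child (T n j)) [] := fun n => by
    simpa only [hiff] using Avoids.exists_not hΦ hb n
  choose g y hg using fun n => exists_isSelected (hT n) (hacc n) (h0 n)
  have hsel : ∀ n k, (∃ y, IsSelected (T n) k y) ↔ g n = k := fun n k =>
    ⟨fun ⟨_, h⟩ => (hg n).eq h (hacc n) (h0 n), fun h => h ▸ ⟨y n, hg n⟩⟩
  have hsigma : ∀ D : ℕ × ℕ → ℕ → Bool, Computable₂ D →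
      Sigma11Pairs {p | D p (g p.1) = true} := by
    intro D hD
    obtain ⟨R, hR, h⟩ := exists_sigma11_selected (computable_avoidTree Φ.computable) hD
    refine ⟨R, hR, fun p => ?_⟩
    rw [← h p]
    change D p (g p.1) = true ↔ ∃ k, D p k = true ∧ ∃ y, IsSelected (T p.1) k y
    simp [hsel]
  have hpred : Primrec fun q : (ℕ × ℕ) × ℕ => q.2 - 1 == q.1.2 :=
    Primrec.beq.comp (Primrec.pred.comp Primrec.snd) (Primrec.snd.comp Primrec.fst)
  refine ⟨fun n => g n - 1, fun n => pred_mem_of_forall_not_avoids hΦ hb (hA n)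
    ((hiff n _).1 ((hg n).acc (hacc n) (h0 n))), ?_, ?_⟩
  · simpa using hsigma (fun p k => k - 1 == p.2) hpred.to_comp
  · simpa using hsigma (fun p k => !(k - 1 == p.2)) (Primrec.not.comp hpred).to_comp
end

section
/- For every uniformly Σ¹₁ family (Bₙ) of cofinite subsets of ℕ, there exists a uniformly Σ¹₁ family (Cₙ) of cofinite subsets of ℕ such that ∏ₙBₙ <_M ∏ₙCₙ; that is, the Medvedev degrees of homogeneous Σ¹₁ sets with all factors cofinite are upward dense. -/
open Set

namespace UpwardDense

open Encodable
open Nat.Partrec (Code)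

/-! ### Computability of basic list operations -/

section Computability

variable {α β : Type*} [Primcodable α] [Primcodable β]

theorem computable_map_range {f : α → ℕ → β} {g : α → ℕ} (hf : Computable₂ f)
    (hg : Computable g) : Computable fun a => (List.range (g a)).map (f a) := by
  have h : Computable fun a => Nat.rec (motive := fun _ => List β) []
      (fun n l => l ++ [f a n]) (g a) := by
    refine Computable.nat_rec (h := fun a p => p.2 ++ [f a p.1]) hg (Computable.const []) ?_
    exact Computable.list_concat.comp (Computable.snd.comp Computable.snd)
      (hf.comp Computable.fst (Computable.fst.comp Computable.snd))
  refine h.of_eq fun a => ?_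
  induction g a with
  | zero => rfl
  | succ n ih => simp [List.range_succ, ih]

theorem computable_all_range {f : α → ℕ → Bool} {g : α → ℕ} (hf : Computable₂ f)
    (hg : Computable g) : Computable fun a => (List.range (g a)).all (f a) := by
  have h : Computable fun a => Nat.rec (motive := fun _ => Bool) true
      (fun n l => l && f a n) (g a) := by
    refine Computable.nat_rec (h := fun a p => p.2 && f a p.1) hg (Computable.const true) ?_
    exact Primrec.and.to_comp.comp (Computable.snd.comp Computable.snd)
      (hf.comp Computable.fst (Computable.fst.comp Computable.snd))
  refine h.of_eq fun a => ?_
  induction g a with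
  | zero => rfl
  | succ n ih => simp [List.range_succ, ih]

theorem computable_getD : Computable₂ fun (σ : List ℕ) (i : ℕ) => σ.getD i 0 :=
  Computable.option_getD (Computable.list_getElem?.comp Computable.fst Computable.snd)
    (Computable.const 0)

/-- The first `l` entries of the `a`-th column of `σ`. -/
def col (σ : List ℕ) (a l : ℕ) : List ℕ :=
  (List.range l).map fun i => σ.getD (Nat.pair a i) 0

theorem computable_col : Computable fun p : List ℕ × ℕ × ℕ => col p.1 p.2.1 p.2.2 := by
  refine computable_map_range (f := fun (p : List ℕ × ℕ × ℕ) i => p.1.getD (Nat.pair p.2.1 i) 0)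
    ?_ (Computable.snd.comp Computable.snd)
  exact computable_getD.comp (Computable.fst.comp Computable.fst)
    (Primrec₂.natPair.to_comp.comp
      (Computable.fst.comp (Computable.snd.comp Computable.fst)) Computable.snd)

/-- The initial segment of `σ` of length `l`, padded with zeros. -/
def initSeg (σ : List ℕ) (l : ℕ) : List ℕ := pre (fun i => σ.getD i 0) l

theorem computable_initSeg : Computable₂ initSeg := by
  refine computable_map_range (f := fun (p : List ℕ × ℕ) i => p.1.getD i 0) ?_ Computable.snd
  exact computable_getD.comp (Computable.fst.comp Computable.fst) Computable.snd

end Computability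

/-! ### Initial segments -/

@[simp] theorem length_pre (x : Baire) (n : ℕ) : (pre x n).length = n := by simp [pre]

theorem pre_succ (x : Baire) (n : ℕ) : pre x (n + 1) = pre x n ++ [x n] := by
  simp [pre, List.range_succ]

theorem pre_congr {x y : Baire} {n : ℕ} (h : ∀ i < n, x i = y i) : pre x n = pre y n := by
  simpa [pre] using h

theorem getElem?_pre {x : Baire} {n i : ℕ} (h : i < n) : (pre x n)[i]? = some (x i) := by
  simp [pre, h]

theorem getD_pre {x : Baire} {n i : ℕ} (h : i < n) : (pre x n).getD i 0 = x i := by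
  simp [pre, h]

theorem initSeg_pre {x : Baire} {n l : ℕ} (h : l ≤ n) : initSeg (pre x n) l = pre x l :=
  pre_congr fun _ hi => getD_pre (hi.trans_le h)

theorem col_pre {x : Baire} {a l k : ℕ} (h : ∀ i < l, Nat.pair a i < k) :
    col (pre x k) a l = pre (fun i => x (Nat.pair a i)) l :=
  pre_congr (x := fun i => (pre x k).getD (Nat.pair a i) 0) fun i hi => getD_pre (h i hi)

theorem pre_getD (σ : List ℕ) : pre (fun i => σ.getD i 0) σ.length = σ := by
  apply List.ext_getElem?
  intro i
  by_cases h : i < σ.length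
  · rw [getElem?_pre h]
    simp [h]
  · simp [pre, h]

theorem initSeg_eq_take {σ : List ℕ} {l : ℕ} (h : l ≤ σ.length) : initSeg σ l = σ.take l := by
  apply List.ext_getElem?
  intro i
  by_cases hi : i < l
  · rw [initSeg, getElem?_pre hi]
    simp [hi, List.getElem?_eq_getElem (hi.trans_le h)]
  · simp [initSeg, pre, hi]

theorem pre_isPrefix (x : Baire) {m n : ℕ} (h : m ≤ n) : pre x m <+: pre x n := by
  rw [← initSeg_pre h, initSeg_eq_take (by simpa using h)]
  exact ⟨_, List.take_append_drop _ _⟩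

theorem isOpen_setOf_pre (k : ℕ) (S : Set (List ℕ)) : IsOpen {c : Baire | pre c k ∈ S} := by
  have h : Continuous fun (c : Baire) (i : Fin k) => c i := by fun_prop
  have : {c : Baire | pre c k ∈ S} =
      (fun (c : Baire) (i : Fin k) => c i) ⁻¹' {f | List.ofFn f ∈ S} := by
    ext c
    have : List.ofFn (fun i : Fin k => c i) = pre c k := by
      apply List.ext_getElem <;> simp [pre]
    simp [this]
  rw [this]
  exact (isOpen_discrete _).preimage h

/-! ### Closure properties of `Σ¹₁` predicates -/

/-- A predicate on a coded type is `Σ¹₁`. -/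
def Sigma11 {α : Type*} [Primcodable α] (P : α → Prop) : Prop :=
  ∃ R : α → List ℕ → Bool, Computable₂ R ∧ ∀ a, P a ↔ ∃ y : Baire, ∀ k, R a (pre y k) = true

namespace Sigma11

variable {α β : Type*} [Primcodable α] [Primcodable β]

theorem of_bool {f : α → Bool} (hf : Computable f) : Sigma11 fun a => f a = true :=
  ⟨fun a _ => f a, hf.comp Computable.fst, fun a => by simp⟩

theorem comp {P : α → Prop} (hP : Sigma11 P) {g : β → α} (hg : Computable g) :
    Sigma11 fun b => P (g b) := by
  obtain ⟨R, hR, h⟩ := hP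
  exact ⟨fun b σ => R (g b) σ, hR.comp (hg.comp Computable.fst) Computable.snd, fun b => h (g b)⟩

theorem imp {P : α → Prop} (hP : Sigma11 P) {f : α → Bool} (hf : Computable f) :
    Sigma11 fun a => f a = true → P a := by
  obtain ⟨R, hR, h⟩ := hP
  refine ⟨fun a σ => !f a || R a σ, ?_, fun a => ?_⟩
  · exact Primrec.or.to_comp.comp (Primrec.not.to_comp.comp (hf.comp Computable.fst)) hR
  · simp only [h a]
    cases f a <;> simp

theorem and {P : α → Prop} (hP : Sigma11 P) {f : α → Bool} (hf : Computable f) :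
    Sigma11 fun a => f a = true ∧ P a := by
  obtain ⟨R, hR, h⟩ := hP
  refine ⟨fun a σ => f a && R a σ, Primrec.and.to_comp.comp (hf.comp Computable.fst) hR,
    fun a => ?_⟩
  simp only [h a]
  cases f a <;> simp

theorem all {P : α → ℕ → Prop} (hP : Sigma11 fun p : α × ℕ => P p.1 p.2) :
    Sigma11 fun a => ∀ n, P a n := by
  obtain ⟨R, hR, h⟩ := hP
  refine ⟨fun a σ => R (a, σ.length.unpair.1) (col σ σ.length.unpair.1 σ.length.unpair.2),
    ?_, fun a => ?_⟩
  · have hu : Computable fun p : α × List ℕ => p.2.length.unpair :=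
      Computable.unpair.comp (Computable.list_length.comp Computable.snd)
    exact hR.comp (Computable.fst.pair (Computable.fst.comp hu))
      (computable_col.comp (Computable.snd.pair hu))
  · have key : ∀ (y : Baire) (n l : ℕ), col (pre y (Nat.pair n l)) n l =
        pre (fun i => y (Nat.pair n i)) l :=
      fun y n l => col_pre fun i hi => Nat.pair_lt_pair_right n hi
    constructor
    · intro H
      choose y hy using fun n => (h (a, n)).1 (H n)
      refine ⟨fun k => y k.unpair.1 k.unpair.2, fun k => ?_⟩
      obtain ⟨n, l, rfl⟩ : ∃ n l, k = Nat.pair n l := ⟨_, _, (Nat.pair_unpair k).symm⟩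
      simp only [length_pre, Nat.unpair_pair, key]
      exact hy n l
    · rintro ⟨y, hy⟩ n
      refine (h (a, n)).2 ⟨fun i => y (Nat.pair n i), fun l => ?_⟩
      simpa only [length_pre, Nat.unpair_pair, key] using hy (Nat.pair n l)

theorem all_list {P : α → List ℕ → Prop} (hP : Sigma11 fun p : α × List ℕ => P p.1 p.2) :
    Sigma11 fun a => ∀ σ, P a σ := by
  have h := all (P := fun a n => P a (Denumerable.ofNat (List ℕ) n))
    (hP.comp (Computable.fst.pair ((Computable.ofNat (List ℕ)).comp Computable.snd)))
  convert h using 2 with a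
  exact ⟨fun H n => H _, fun H σ => by simpa only [Denumerable.ofNat_encode] using H (encode σ)⟩

theorem ex {P : α → ℕ → Prop} (hP : Sigma11 fun p : α × ℕ => P p.1 p.2) :
    Sigma11 fun a => ∃ n, P a n := by
  obtain ⟨R, hR, h⟩ := hP
  refine ⟨fun a σ => (σ.length == 0) ||
    R (a, σ.getD 0 0) ((List.range (σ.length - 1)).map fun i => σ.getD (i + 1) 0), ?_, fun a => ?_⟩
  · refine Primrec.or.to_comp.comp ?_ (hR.comp ?_ ?_)
    · exact Primrec.beq.to_comp.comp (Computable.list_length.comp Computable.snd)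
        (Computable.const 0)
    · exact Computable.fst.pair (computable_getD.comp Computable.snd (Computable.const 0))
    · refine computable_map_range (f := fun (p : α × List ℕ) i => p.2.getD (i + 1) 0) ?_ ?_
      · exact computable_getD.comp (Computable.snd.comp Computable.fst)
          (Computable.succ.comp Computable.snd)
      · exact Computable.pred.comp (Computable.list_length.comp Computable.snd)
  · have key : ∀ (y : Baire) (k : ℕ), ((List.range k).map fun i => (pre y (k + 1)).getD (i + 1) 0) =
        pre (fun i => y (i + 1)) k := fun y k =>
      pre_congr (x := fun i => (pre y (k + 1)).getD (i + 1) 0) fun i hi => getD_pre (by omega)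
    have key0 : ∀ (y : Baire) (k : ℕ), (pre y (k + 1)).getD 0 0 = y 0 :=
      fun y k => getD_pre (by omega)
    constructor
    · rintro ⟨n, hn⟩
      obtain ⟨y, hy⟩ := (h (a, n)).1 hn
      refine ⟨fun k => Nat.casesOn k n y, fun k => ?_⟩
      cases k with
      | zero => simp
      | succ k =>
        beta_reduce
        rw [length_pre, key0, Nat.add_sub_cancel, key]
        simpa using hy k
    · rintro ⟨y, hy⟩
      refine ⟨y 0, (h (a, y 0)).2 ⟨fun i => y (i + 1), fun k => ?_⟩⟩
      have := hy (k + 1)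
      beta_reduce at this
      rw [length_pre, key0, Nat.add_sub_cancel, key] at this
      simpa using this

theorem or {P Q : α → Prop} (hP : Sigma11 P) (hQ : Sigma11 Q) : Sigma11 fun a => P a ∨ Q a := by
  obtain ⟨R, hR, h⟩ := hP
  obtain ⟨S, hS, h'⟩ := hQ
  have : Sigma11 fun a => ∃ n, (n = 0 ∧ P a) ∨ (n ≠ 0 ∧ Q a) := by
    refine ex (P := fun a n => (n = 0 ∧ P a) ∨ (n ≠ 0 ∧ Q a))
      ⟨fun p σ => bif p.2 == 0 then R p.1 σ else S p.1 σ, ?_, ?_⟩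
    · refine Computable.cond (Primrec.beq.to_comp.comp (Computable.snd.comp Computable.fst)
        (Computable.const 0)) (hR.comp ?_ ?_) (hS.comp ?_ ?_)
      · exact Computable.fst.comp Computable.fst
      · exact Computable.snd
      · exact Computable.fst.comp Computable.fst
      · exact Computable.snd
    · rintro ⟨a, n⟩
      rcases n with _ | n
      · simp [h]
      · simp [h']
  convert this using 2 with a
  constructor
  · rintro (h | h)
    exacts [⟨0, .inl ⟨rfl, h⟩⟩, ⟨1, .inr ⟨one_ne_zero, h⟩⟩]
  · rintro ⟨n, h | h⟩
    exacts [.inl h.2, .inr h.2]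

theorem exists_forall {Q : α → List ℕ → List ℕ → Bool}
    (hQ : Computable fun p : α × List ℕ × List ℕ => Q p.1 p.2.1 p.2.2) :
    Sigma11 fun a => ∃ y : Baire, ∀ u : List ℕ, Q a u (pre y (encode u + 1)) = true := by
  refine ⟨fun a σ => (σ.length == 0) || Q a (Denumerable.ofNat (List ℕ) (σ.length - 1)) σ, ?_,
    fun a => ?_⟩
  · have hl : Computable fun p : α × List ℕ => p.2.length :=
      Computable.list_length.comp Computable.snd
    refine Primrec.or.to_comp.comp (Primrec.beq.to_comp.comp hl (Computable.const 0)) ?_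
    exact hQ.comp (Computable.fst.pair
      (((Computable.ofNat _).comp (Computable.pred.comp hl)).pair Computable.snd))
  · refine exists_congr fun y => ⟨fun H k => ?_, fun H u => ?_⟩
    · cases k with
      | zero => simp
      | succ k => simpa using H (Denumerable.ofNat (List ℕ) k)
    · simpa using H (encode u + 1)

end Sigma11

/-! ### Homomorphisms between trees -/

/-- The sequence of values of `y` at (codes of) the nonempty prefixes of `u`. -/
def labels (y : Baire) (u : List ℕ) : List ℕ :=
  (List.range u.length).map fun i => y (encode (u.take (i + 1)))

theorem labels_cons (y : Baire) (a : ℕ) (u : List ℕ) :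
    labels y (a :: u) =
      y (encode [a]) :: labels (fun i => y (encode (a :: Denumerable.ofNat (List ℕ) i))) u := by
  simp [labels, List.range_succ_eq_map, Function.comp_def]

/-- The nodes extending `t` in the tree of `T` map, level by level and monotonically,
to the nodes extending `s` in the tree of `S`. -/
def TreeHom (T S : List ℕ → Prop) (t s : List ℕ) : Prop :=
  ∃ y : Baire, ∀ u : List ℕ, (∀ j ≤ u.length, T (t ++ u.take j)) → S (s ++ labels y u)

theorem TreeHom.of_not {T S : List ℕ → Prop} {t s : List ℕ} (h : ¬ T t) : TreeHom T S t s :=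
  ⟨0, fun u hu => absurd (by simpa using hu 0 (Nat.zero_le _)) h⟩

theorem TreeHom.glue {T S : List ℕ → Prop} {t s : List ℕ} (hs : S s)
    (h : ∀ a, ∃ b, TreeHom T S (t ++ [a]) (s ++ [b])) : TreeHom T S t s := by
  choose b y hy using h
  let Y : List ℕ → ℕ := fun l => match l with
    | [] => 0
    | [a] => b a
    | a :: c :: u => y a (encode (c :: u))
  refine ⟨fun k => Y (Denumerable.ofNat (List ℕ) k), fun u hu => ?_⟩
  cases u with
  | nil => simpa [labels] using hs
  | cons a u =>
    have h1 := hy a u fun j hj => by simpa using hu (j + 1) (by simpa using hj)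
    have h2 : labels (fun k => Y (Denumerable.ofNat (List ℕ) k)) (a :: u) =
        b a :: labels (y a) u := by
      rw [labels_cons]
      congr 1
      · simp [Y]
      · simp only [labels, Denumerable.ofNat_encode]
        refine List.map_congr_left fun i hi => ?_
        cases u with
        | nil => simp at hi
        | cons c u => simp [Y]
    simpa [h2] using h1

theorem TreeHom.of_path {T S : List ℕ → Prop} {z : Baire} (hz : ∀ k, S (pre z k)) :
    TreeHom T S [] [] := by
  refine ⟨fun k => z ((Denumerable.ofNat (List ℕ) k).length - 1), fun u _ => ?_⟩
  convert hz u.length using 1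
  simp only [List.nil_append, labels, pre, Denumerable.ofNat_encode]
  refine List.map_congr_left fun i hi => ?_
  have := List.mem_range.1 hi
  congr 1
  simp
  omega

theorem TreeHom.exists_path {T S : List ℕ → Prop} (h : TreeHom T S [] []) {y : Baire}
    (hy : ∀ k, T (pre y k)) : ∃ z : Baire, ∀ k, S (pre z k) := by
  obtain ⟨f, hf⟩ := h
  refine ⟨fun i => f (encode (pre y (i + 1))), fun k => ?_⟩
  have := hf (pre y k) fun j hj => by
    rw [length_pre] at hj
    rw [List.nil_append, ← initSeg_eq_take (by simpa using hj), initSeg_pre hj]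
    exact hy j
  convert this using 1
  simp only [List.nil_append, labels, length_pre]
  refine List.map_congr_left fun i hi => ?_
  have := List.mem_range.1 hi
  rw [← initSeg_eq_take (by simpa using this), initSeg_pre (by omega)]

/-- If no `T n` maps to `S`, one gets branches of all the `T n` simultaneously, provided the
combination `Z` of these branches does not leave `S` before one of the branches leaves `T n`. -/
theorem exists_paths_of_not_treeHom {T : ℕ → List ℕ → Prop} {S : List ℕ → Prop}
    (Z : (ℕ → Baire) → Baire)
    (hZ : ∀ y y' k, (∀ n, ∀ i < k, y n i = y' n i) → ∀ i < k, Z y i = Z y' i)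
    (hS : ∀ y k, (∀ n, ∀ j ≤ k, T n (pre (y n) j)) → S (pre (Z y) k))
    (h : ∀ n, ¬ TreeHom (T n) S [] []) : ∃ y : ℕ → Baire, ∀ n k, T n (pre (y n) k) := by
  classical
  let pick : ℕ → List ℕ → List ℕ → ℕ := fun n t s =>
    if h : ∃ a, ∀ b, ¬ TreeHom (T n) S (t ++ [a]) (s ++ [b]) then h.choose else 0
  let st : ℕ → ℕ → List ℕ := fun k => Nat.rec (fun _ => [])
    (fun k t n => t n ++ [pick n (t n) (pre (Z fun m i => (t m).getD i 0) k)]) k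
  let y : ℕ → Baire := fun n k =>
    pick n (st k n) (pre (Z fun m i => (st k m).getD i 0) k)
  have hst : ∀ k n, st k n = pre (y n) k := by
    intro k
    induction k with
    | zero => intro n; rfl
    | succ k ih => intro n; rw [pre_succ, ← ih n]
  have hy : ∀ n k, y n k = pick n (pre (y n) k) (pre (Z y) k) := by
    intro n k
    have : pre (Z fun m i => (st k m).getD i 0) k = pre (Z y) k :=
      pre_congr (hZ _ _ k fun m i hi => by rw [hst, getD_pre hi])
    change pick n (st k n) _ = _
    rw [hst, this]
  have key : ∀ k n, ¬ TreeHom (T n) S (pre (y n) k) (pre (Z y) k) := by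
    intro k
    induction k using Nat.strong_induction_on with
    | _ k ih =>
      cases k with
      | zero => exact h
      | succ k =>
        intro n
        have hs : S (pre (Z y) k) := hS y k fun m j hj => by
          by_contra hc
          exact ih j (by omega) m (TreeHom.of_not hc)
        have hex : ∃ a, ∀ b, ¬ TreeHom (T n) S (pre (y n) k ++ [a]) (pre (Z y) k ++ [b]) := by
          by_contra! hc
          exact ih k (by omega) n (TreeHom.glue hs hc)
        have h2 : y n k = hex.choose := (hy n k).trans (dif_pos hex)
        rw [pre_succ, pre_succ, h2]
        exact hex.choose_spec _
  exact ⟨y, fun n k => by_contra fun hc => key k n (TreeHom.of_not hc)⟩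

theorem encode_take_le (u : List ℕ) (j : ℕ) : encode (u.take j) ≤ encode u := by
  induction u generalizing j with
  | nil => simp
  | cons a u ih =>
    cases j with
    | zero => simp
    | succ j =>
      simp only [List.take_succ_cons, encode_list_cons]
      have h : ∀ {b c : ℕ}, b ≤ c → Nat.pair (encode a) b ≤ Nat.pair (encode a) c := by
        intro b c hbc
        rcases hbc.eq_or_lt with rfl | hlt
        · exact le_rfl
        · exact (Nat.pair_lt_pair_right _ hlt).le
      exact Nat.succ_le_succ (h (ih j))

theorem sigma11_treeHom {α : Type*} [Primcodable α] {T S : α → List ℕ → Bool}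
    (hT : Computable₂ T) (hS : Computable₂ S) :
    Sigma11 fun a => TreeHom (fun t => T a t = true) (fun s => S a s = true) [] [] := by
  have hc : Computable fun p : α × List ℕ × List ℕ =>
      !((List.range (p.2.1.length + 1)).all fun j => T p.1 (initSeg p.2.1 j)) ||
        S p.1 ((List.range p.2.1.length).map fun i =>
          p.2.2.getD (encode (initSeg p.2.1 (i + 1))) 0) := by
    have hu : Computable fun p : α × List ℕ × List ℕ => p.2.1 :=
      Computable.fst.comp Computable.snd
    have hl := Computable.list_length.comp hu
    refine Primrec.or.to_comp.comp (Primrec.not.to_comp.comp ?_) (hS.comp Computable.fst ?_)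
    · refine computable_all_range
        (f := fun (p : α × List ℕ × List ℕ) j => T p.1 (initSeg p.2.1 j)) ?_
        (Computable.succ.comp hl)
      exact hT.comp (Computable.fst.comp Computable.fst)
        (computable_initSeg.comp (hu.comp Computable.fst) Computable.snd)
    · refine computable_map_range (f := fun (p : α × List ℕ × List ℕ) i =>
        p.2.2.getD (encode (initSeg p.2.1 (i + 1))) 0) ?_ hl
      exact computable_getD.comp (Computable.snd.comp (Computable.snd.comp Computable.fst))
        (Computable.encode.comp (computable_initSeg.comp (hu.comp Computable.fst)
          (Computable.succ.comp Computable.snd)))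
  refine (funext fun a => propext (exists_congr fun y => forall_congr' fun u => ?_)) ▸
    Sigma11.exists_forall (Q := fun a u σ =>
      !((List.range (u.length + 1)).all fun j => T a (initSeg u j)) ||
        S a ((List.range u.length).map fun i => σ.getD (encode (initSeg u (i + 1))) 0)) hc
  have h1 : ((List.range u.length).map fun i =>
      (pre y (encode u + 1)).getD (encode (initSeg u (i + 1))) 0) = labels y u := by
    refine List.map_congr_left fun i hi => ?_
    have := List.mem_range.1 hi
    rw [initSeg_eq_take (by omega), getD_pre (Nat.lt_succ_of_le (encode_take_le u _))]
  have h2 : ((List.range (u.length + 1)).all fun j => T a (initSeg u j)) = true ↔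
      ∀ j ≤ u.length, T a (u.take j) = true := by
    simp only [List.all_eq_true, List.mem_range, Nat.lt_succ_iff]
    exact forall₂_congr fun j hj => by rw [initSeg_eq_take hj]
  simp only [h1, Bool.or_eq_true, Bool.not_eq_true', ← Bool.not_eq_true, h2, List.nil_append]
  exact imp_iff_not_or.symm

/-! ### The diagonal family -/

/-- The value at coordinate `2 * e + 1` output by the `e`-th partial computable function on an
initial segment of `σ`, where the segment and the time bound are coded by the length of `σ`. -/
def outAt (e : ℕ) (σ : List ℕ) : Option ℕ :=
  (Code.evaln σ.length (Denumerable.ofNat Code e)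
    (encode (initSeg σ σ.length.unpair.1))).bind
      fun w => (Denumerable.ofNat (List ℕ) w)[2 * e + 1]?

theorem computable_outAt : Computable₂ outAt := by
  have hl : Computable fun p : ℕ × List ℕ => p.2.length :=
    Computable.list_length.comp Computable.snd
  refine Computable.option_bind (Code.primrec_evaln.to_comp.comp
    ((hl.pair ((Computable.ofNat Code).comp Computable.fst)).pair (Computable.encode.comp
      (computable_initSeg.comp Computable.snd
        (Computable.fst.comp (Computable.unpair.comp hl)))))) ?_
  exact Computable.list_getElem?.comp ((Computable.ofNat _).comp Computable.snd)
    (Primrec.nat_double_succ.to_comp.comp (Computable.fst.comp Computable.fst))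

/-- The sequence with columns `c, y 0, y 1, …`. -/
def combine (c : Baire) (y : ℕ → Baire) : Baire := fun k =>
  Nat.casesOn k.unpair.1 (c k.unpair.2) fun n => y n k.unpair.2

theorem combine_zero (c : Baire) (y : ℕ → Baire) (i : ℕ) : combine c y (Nat.pair 0 i) = c i := by
  simp [combine]

theorem combine_succ (c : Baire) (y : ℕ → Baire) (n i : ℕ) :
    combine c y (Nat.pair (n + 1) i) = y n i := by
  simp [combine]

/-- Paths `z` of this tree consist of a sequence `c` on which the `e`-th functional has no output
at `2 * e + 1`, together with witnesses for `c n` belonging to the `n`-th set coded by `R`. -/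
def divTree (R : ℕ × ℕ → List ℕ → Bool) (e : ℕ) (s : List ℕ) : Bool :=
  (outAt e (col s 0 s.length.unpair.2)).isNone && (s.length.unpair.1 == 0 ||
    R (s.length.unpair.1 - 1, s.getD (Nat.pair 0 (s.length.unpair.1 - 1)) 0)
      (col s s.length.unpair.1 s.length.unpair.2))

theorem computable_divTree {R : ℕ × ℕ → List ℕ → Bool} (hR : Computable₂ R) :
    Computable₂ (divTree R) := by
  have hl : Computable fun p : ℕ × List ℕ => p.2.length.unpair :=
    Computable.unpair.comp (Computable.list_length.comp Computable.snd)
  have h1 := Computable.fst.comp hl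
  have h2 := Computable.snd.comp hl
  have h3 := Computable.pred.comp h1
  refine Primrec.and.to_comp.comp ?_ (Primrec.or.to_comp.comp ?_ (hR.comp (h3.pair ?_) ?_))
  · have h : Primrec fun o : Option ℕ => o.isNone :=
      (Primrec.not.comp Primrec.option_isSome).of_eq fun o => by cases o <;> rfl
    exact h.to_comp.comp (computable_outAt.comp Computable.fst (computable_col.comp
      (Computable.snd.pair ((Computable.const 0).pair h2))))
  · exact Primrec.beq.to_comp.comp h1 (Computable.const 0)
  · exact computable_getD.comp Computable.snd
      (Primrec₂.natPair.to_comp.comp (Computable.const 0) h3)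
  · exact computable_col.comp (g := fun p : ℕ × List ℕ =>
      (p.2, p.2.length.unpair.1, p.2.length.unpair.2)) (Computable.snd.pair (h1.pair h2))

theorem pair_zero_lt {i n l : ℕ} (h : i < l ∨ i < n) : Nat.pair 0 i < Nat.pair n l := by
  have h1 : i < max n l := lt_max_iff.2 h.symm
  have h2 := Nat.max_sq_add_min_le_pair n l
  have h3 : Nat.pair 0 i = i * i := by
    unfold Nat.pair
    split_ifs <;> simp_all
  nlinarith [Nat.zero_le (min n l)]

theorem divTree_pre (R : ℕ × ℕ → List ℕ → Bool) (e : ℕ) (z : Baire) (n l : ℕ) :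
    divTree R e (pre z (Nat.pair n l)) = true ↔
      outAt e (pre (fun i => z (Nat.pair 0 i)) l) = none ∧
      (n = 0 ∨ R (n - 1, z (Nat.pair 0 (n - 1))) (pre (fun i => z (Nat.pair n i)) l) = true) := by
  have h1 : col (pre z (Nat.pair n l)) 0 l = pre (fun i => z (Nat.pair 0 i)) l :=
    col_pre fun i hi => pair_zero_lt (.inl hi)
  have h2 : col (pre z (Nat.pair n l)) n l = pre (fun i => z (Nat.pair n i)) l :=
    col_pre fun i hi => Nat.pair_lt_pair_right n hi
  rcases n with _ | n
  · simp [divTree, h1]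
  · have h3 : (pre z (Nat.pair (n + 1) l)).getD (Nat.pair 0 n) 0 = z (Nat.pair 0 n) :=
      getD_pre (pair_zero_lt (.inr n.lt_succ_self))
    simp only [divTree, length_pre, Nat.unpair_pair, Nat.add_sub_cancel, h1, h2, h3]
    simp

/-- The tree of witnesses of `m ∈ B n` has rank at most that of `divTree R e`. -/
def Dominated (R : ℕ × ℕ → List ℕ → Bool) (e n m : ℕ) : Prop :=
  TreeHom (fun t => R (n, m) t = true) (fun s => divTree R e s = true) [] []

/-- The `e`-th set of the diagonal family. -/
def diagSet (R : ℕ × ℕ → List ℕ → Bool) (B : ℕ → Set ℕ) (e : ℕ) : Set ℕ :=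
  {m | ∀ σ : List ℕ, outAt e σ = some m → ∃ n, n < σ.length ∧
    ((outAt e (initSeg σ n) ≠ none ∨ Dominated R e n (σ.getD n 0)) ∨
      ∃ j, j < σ.getD n 0 ∧ j ∈ B n)}

theorem sigma11_dominated {R : ℕ × ℕ → List ℕ → Bool} (hR : Computable₂ R) :
    Sigma11 fun p : ℕ × ℕ × ℕ => Dominated R p.1 p.2.1 p.2.2 :=
  sigma11_treeHom (T := fun p : ℕ × ℕ × ℕ => R p.2) (S := fun p => divTree R p.1)
    (hR.comp (Computable.snd.comp Computable.fst) Computable.snd)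
    ((computable_divTree hR).comp (Computable.fst.comp Computable.fst) Computable.snd)

theorem sigma11_exists_escape {R : ℕ × ℕ → List ℕ → Bool} (hR : Computable₂ R) {B : ℕ → Set ℕ}
    (hB : Sigma11 fun p : ℕ × ℕ => p.2 ∈ B p.1) :
    Sigma11 fun q : ℕ × List ℕ => ∃ n, n < q.2.length ∧
      ((outAt q.1 (initSeg q.2 n) ≠ none ∨ Dominated R q.1 n (q.2.getD n 0)) ∨
        ∃ j, j < q.2.getD n 0 ∧ j ∈ B n) := by
  have hlt : Computable₂ fun a b : ℕ => decide (a < b) := Primrec.nat_lt.decide.to_comp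
  have h1 : Sigma11 fun q : (ℕ × List ℕ) × ℕ =>
      ((outAt q.1.1 (initSeg q.1.2 q.2)).isSome = true ∨
        Dominated R q.1.1 q.2 (q.1.2.getD q.2 0)) ∨
      ∃ j, decide (j < q.1.2.getD q.2 0) = true ∧ j ∈ B q.2 := by
    have he : Computable fun q : (ℕ × List ℕ) × ℕ => q.1.1 := Computable.fst.comp Computable.fst
    have hσ : Computable fun q : (ℕ × List ℕ) × ℕ => q.1.2 := Computable.snd.comp Computable.fst
    have hget : Computable fun q : (ℕ × List ℕ) × ℕ => q.1.2.getD q.2 0 :=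
      computable_getD.comp hσ Computable.snd
    refine Sigma11.or (Sigma11.or (Sigma11.of_bool ?_) ?_) (Sigma11.ex
      (P := fun (q : (ℕ × List ℕ) × ℕ) j => decide (j < q.1.2.getD q.2 0) = true ∧ j ∈ B q.2) ?_)
    · exact Primrec.option_isSome.to_comp.comp
        (computable_outAt.comp he (computable_initSeg.comp hσ Computable.snd))
    · exact (sigma11_dominated hR).comp (g := fun q : (ℕ × List ℕ) × ℕ =>
        (q.1.1, q.2, q.1.2.getD q.2 0)) (he.pair (Computable.snd.pair hget))
    · exact (hB.comp (g := fun q : ((ℕ × List ℕ) × ℕ) × ℕ => (q.1.2, q.2))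
        ((Computable.snd.comp Computable.fst).pair Computable.snd)).and
        (f := fun q : ((ℕ × List ℕ) × ℕ) × ℕ => decide (q.2 < q.1.1.2.getD q.1.2 0))
        (hlt.comp Computable.snd (hget.comp Computable.fst))
  have h2 : Sigma11 fun q : ℕ × List ℕ => ∃ n, decide (n < q.2.length) = true ∧
      (((outAt q.1 (initSeg q.2 n)).isSome = true ∨ Dominated R q.1 n (q.2.getD n 0)) ∨
        ∃ j, decide (j < q.2.getD n 0) = true ∧ j ∈ B n) :=
    Sigma11.ex (P := fun (q : ℕ × List ℕ) n => decide (n < q.2.length) = true ∧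
      (((outAt q.1 (initSeg q.2 n)).isSome = true ∨ Dominated R q.1 n (q.2.getD n 0)) ∨
        ∃ j, decide (j < q.2.getD n 0) = true ∧ j ∈ B n)) (h1.and
      (f := fun q : (ℕ × List ℕ) × ℕ => decide (q.2 < q.1.2.length))
      (hlt.comp Computable.snd (Computable.list_length.comp
        (Computable.snd.comp Computable.fst))))
  simpa only [decide_eq_true_eq, Option.isSome_iff_ne_none] using h2

theorem sigma11_diagSet {R : ℕ × ℕ → List ℕ → Bool} (hR : Computable₂ R) {B : ℕ → Set ℕ}
    (hB : Sigma11 fun p : ℕ × ℕ => p.2 ∈ B p.1) :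
    Sigma11 fun p : ℕ × ℕ => p.2 ∈ diagSet R B p.1 := by
  have h3 := sigma11_exists_escape hR hB
  have he : Computable fun p : (ℕ × ℕ) × List ℕ => p.1.1 := Computable.fst.comp Computable.fst
  have h4 := (h3.comp (he.pair Computable.snd)).imp
    (f := fun p : (ℕ × ℕ) × List ℕ => decide (outAt p.1.1 p.2 = some p.1.2))
    (Primrec.eq.decide.to_comp.comp (computable_outAt.comp he Computable.snd)
      (Computable.option_some.comp (Computable.snd.comp Computable.fst)))
  simp only [decide_eq_true_eq] at h4
  exact Sigma11.all_list (P := fun (p : ℕ × ℕ) σ => outAt p.1 σ = some p.2 →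
    ∃ n, n < σ.length ∧ ((outAt p.1 (initSeg σ n) ≠ none ∨ Dominated R p.1 n (σ.getD n 0)) ∨
      ∃ j, j < σ.getD n 0 ∧ j ∈ B n)) h4

/-- The `e`-th functional outputs a value at `2 * e + 1` on every element of `∏ₙ Bₙ`. -/
def Converges (B : ℕ → Set ℕ) (e : ℕ) : Prop :=
  ∀ c ∈ homProd B, ∃ k, outAt e (pre c k) ≠ none

section

variable {R : ℕ × ℕ → List ℕ → Bool} {B : ℕ → Set ℕ} {e : ℕ}
  (hRB : ∀ n m : ℕ, m ∈ B n ↔ ∃ y : Baire, ∀ k, R (n, m) (pre y k) = true)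

include hRB

theorem exists_path_divTree_iff :
    (∃ z : Baire, ∀ k, divTree R e (pre z k) = true) ↔ ¬ Converges B e := by
  constructor
  · rintro ⟨z, hz⟩ H
    have hz' := fun n l => (divTree_pre R e z n l).1 (hz _)
    obtain ⟨k, hk⟩ := H (fun i => z (Nat.pair 0 i)) fun n =>
      (hRB _ _).2 ⟨fun i => z (Nat.pair (n + 1) i), fun k => by
        simpa using (hz' (n + 1) k).2⟩
    exact hk (hz' 0 k).1
  · intro H
    simp only [Converges, not_forall, not_exists, not_not] at H
    obtain ⟨c, hc, hk⟩ := H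
    choose y hy using fun n => (hRB n (c n)).1 (hc n)
    refine ⟨combine c y, fun k => ?_⟩
    rw [← Nat.pair_unpair k, divTree_pre]
    simp only [combine_zero]
    refine ⟨hk _, ?_⟩
    cases k.unpair.1 with
    | zero => exact .inl rfl
    | succ n => exact .inr (by simpa only [combine_succ, Nat.add_sub_cancel] using hy n _)

theorem dominated_of_not_converges (h : ¬ Converges B e) (n m : ℕ) : Dominated R e n m := by
  obtain ⟨z, hz⟩ := (exists_path_divTree_iff hRB).2 h
  exact TreeHom.of_path hz

theorem not_dominated_of_mem (h : Converges B e) {n m : ℕ} (hm : m ∈ B n) :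
    ¬ Dominated R e n m := by
  obtain ⟨y, hy⟩ := (hRB n m).1 hm
  exact fun hd => (exists_path_divTree_iff hRB).1 (hd.exists_path hy) h

theorem exists_outAt_of_not_dominated (h : Converges B e) {c : Baire}
    (hc : ∀ n, ¬ Dominated R e n (c n)) : ∃ k, outAt e (pre c k) ≠ none := by
  by_contra! hk
  have hZ : ∀ (y y' : ℕ → Baire) k, (∀ n, ∀ i < k, y n i = y' n i) →
      ∀ i < k, combine c y i = combine c y' i := by
    intro y y' k hyy i hi
    unfold combine
    cases i.unpair.1 with
    | zero => rfl
    | succ n => exact hyy n _ ((Nat.unpair_right_le i).trans_lt hi)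
  have hS : ∀ (y : ℕ → Baire) k, (∀ n, ∀ j ≤ k, R (n, c n) (pre (y n) j) = true) →
      divTree R e (pre (combine c y) k) = true := by
    intro y k hT
    rw [← Nat.pair_unpair k, divTree_pre]
    simp only [combine_zero]
    refine ⟨hk _, ?_⟩
    cases k.unpair.1 with
    | zero => exact .inl rfl
    | succ n =>
      have := hT n _ (Nat.unpair_right_le k)
      exact .inr (by simpa only [combine_succ, Nat.add_sub_cancel] using this)
  obtain ⟨y, hy⟩ := exists_paths_of_not_treeHom (T := fun n t => R (n, c n) t = true)
    (combine c) hZ hS hc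
  obtain ⟨k, hk'⟩ := h c fun n => (hRB _ _).2 ⟨y n, hy n⟩
  exact hk' (hk k)

theorem finite_compl_diagSet (hfin : ∀ n, (B n)ᶜ.Finite) : (diagSet R B e)ᶜ.Finite := by
  by_cases hconv : Converges B e
  swap
  · refine (Set.finite_iff_bddAbove.2 ?_ : {m | outAt e [] = some m}.Finite).subset ?_
    · rcases h : outAt e [] with _ | v
      · simp
      · refine ⟨v, ?_⟩
        rintro m hm
        exact (Option.some_injective _ hm).ge
    · intro m hm
      simp only [diagSet, Set.mem_compl_iff, Set.mem_ofPred_eq, not_forall] at hm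
      obtain ⟨σ, hσ, hn⟩ := hm
      cases σ with
      | nil => exact hσ
      | cons a σ =>
        exact absurd ⟨0, by simp, .inl (.inr (dominated_of_not_converges hRB hconv _ _))⟩ hn
  have hne : ∀ n, ∃ m, m ∈ B n := fun n =>
    (Set.Infinite.nonempty (by simpa using (hfin n).infinite_compl))
  choose b hb using hne
  let K : Set Baire := Set.univ.pi fun n => {m | m ≤ b n ∧ ¬ Dominated R e n m}
  have hK : IsCompact K := isCompact_univ_pi fun n =>
    ((Set.finite_Iic (b n)).subset fun m hm => hm.1).isCompact
  let O : ℕ → Set Baire := fun m =>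
    {c | ∃ k, outAt e (pre c k) = some m ∧ ∀ j < k, outAt e (pre c j) = none}
  have hO : ∀ m, IsOpen (O m) := by
    intro m
    have : O m = ⋃ k, {c | pre c k ∈ {σ | outAt e σ = some m ∧
        ∀ j < k, outAt e (initSeg σ j) = none}} := by
      ext c
      simp only [O, Set.mem_iUnion, Set.mem_ofPred_eq]
      refine exists_congr fun k => and_congr_right fun _ => forall₂_congr fun j hj => ?_
      rw [initSeg_pre hj.le]
    rw [this]
    exact isOpen_iUnion fun k => isOpen_setOf_pre k _
  have hcover : K ⊆ ⋃ m, O m := by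
    intro c hc
    have hex := exists_outAt_of_not_dominated hRB hconv fun n => (hc n trivial).2
    classical
    obtain ⟨m, hm⟩ := Option.ne_none_iff_exists'.1 (Nat.find_spec hex)
    exact Set.mem_iUnion.2 ⟨m, _, hm, fun j hj => not_not.1 (Nat.find_min hex hj)⟩
  obtain ⟨I, hI⟩ := hK.elim_finite_subcover O hO hcover
  refine I.finite_toSet.subset fun m hm => ?_
  simp only [diagSet, Set.mem_compl_iff, Set.mem_ofPred_eq, not_forall, not_exists, not_and,
    not_or, not_not] at hm
  obtain ⟨σ, hσ, hn⟩ := hm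
  let c : Baire := fun i => if i < σ.length then σ.getD i 0 else b i
  have hcσ : pre c σ.length = σ :=
    (pre_congr fun i hi => if_pos hi).trans (pre_getD σ)
  have hcK : c ∈ K := by
    intro n _
    by_cases h : n < σ.length
    · obtain ⟨⟨-, h2⟩, h3⟩ := hn n h
      simp only [c, if_pos h]
      exact ⟨not_lt.1 fun hlt => h3 _ hlt (hb n), h2⟩
    · simp only [c, if_neg h]
      exact ⟨le_rfl, not_dominated_of_mem hRB hconv (hb n)⟩
  obtain ⟨i, hi, k, hk, hkmin⟩ := Set.mem_iUnion₂.1 (hI hcK)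
  have hmin' : ∀ j < σ.length, outAt e (pre c j) = none := by
    intro j hj
    rw [← initSeg_pre hj.le, hcσ]
    exact (hn j hj).1.1
  have hσ' : outAt e (pre c σ.length) = some m := by rw [hcσ, hσ]
  rcases lt_trichotomy k σ.length with h | rfl | h
  · simp [hmin' k h] at hk
  · have : i = m := Option.some_injective _ (hk.symm.trans hσ')
    exact this ▸ hi
  · simp [hkmin _ h] at hσ'

end

theorem outAt_eq {Φ : TuringFunctional} {cd : Code}
    (hcd : ∀ σ : List ℕ, encode (Φ.φ σ) ∈ cd.eval (encode σ)) {σ : List ℕ} {v : ℕ}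
    (h : outAt (encode cd) σ = some v) :
    (Φ.φ (initSeg σ σ.length.unpair.1))[2 * encode cd + 1]? = some v := by
  simp only [outAt, Option.bind_eq_some_iff, Denumerable.ofNat_encode] at h
  obtain ⟨w, hw, hv⟩ := h
  have := Part.mem_unique (Code.evaln_sound hw) (hcd _)
  simpa [this] using hv

theorem exists_outAt {Φ : TuringFunctional} {cd : Code}
    (hcd : ∀ σ : List ℕ, encode (Φ.φ σ) ∈ cd.eval (encode σ)) {c : Baire} {m v : ℕ}
    (h : (Φ.φ (pre c m))[2 * encode cd + 1]? = some v) :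
    ∃ k, outAt (encode cd) (pre c k) ≠ none := by
  obtain ⟨t, ht⟩ := Code.evaln_complete.1 (hcd (pre c m))
  refine ⟨Nat.pair m t, ?_⟩
  have := Code.evaln_mono (Nat.right_le_pair m t) ht
  simp only [outAt, length_pre, Nat.unpair_pair, initSeg_pre (Nat.left_le_pair m t),
    Denumerable.ofNat_encode]
  rw [Option.mem_def.1 this]
  simp [h]

theorem getElem?_eq_of_isPrefix {l l' : List ℕ} (h : l <+: l') {n v : ℕ} (hv : l[n]? = some v) :
    l'[n]? = some v := by
  obtain ⟨r, rfl⟩ := h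
  have := (List.getElem?_eq_some_iff.1 hv).1
  rw [List.getElem?_append_left this, hv]

theorem not_medvedevLE_of_diagSet {R : ℕ × ℕ → List ℕ → Bool} {B C : ℕ → Set ℕ}
    (hRB : ∀ n m : ℕ, m ∈ B n ↔ ∃ y : Baire, ∀ k, R (n, m) (pre y k) = true)
    (hne : ∀ n, (B n).Nonempty) (hC : ∀ e, C (2 * e + 1) ⊆ diagSet R B e) :
    ¬ MedvedevLE (homProd C) (homProd B) := by
  classical
  rintro ⟨Φ, hΦ⟩
  obtain ⟨cd, hcd'⟩ := Code.exists_code.1 Φ.computable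
  have hcd : ∀ σ : List ℕ, encode (Φ.φ σ) ∈ cd.eval (encode σ) := by
    intro σ
    simp [hcd']
  set e := encode cd with he
  have hconv : Converges B e := by
    intro c hc
    obtain ⟨y, -, hy⟩ := hΦ c hc
    obtain ⟨m, hm⟩ := hy (2 * e + 1)
    exact exists_outAt hcd hm
  let b : Baire := fun n => Nat.find (hne n)
  have hb : ∀ n, b n ∈ B n := fun n => Nat.find_spec (hne n)
  obtain ⟨y, hyC, hy⟩ := hΦ b hb
  have hex := hconv b hb
  obtain ⟨v, hv⟩ := Option.ne_none_iff_exists'.1 (Nat.find_spec hex)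
  have hvy : v = y (2 * e + 1) := by
    obtain ⟨m, hm⟩ := hy (2 * e + 1)
    have h1 := outAt_eq hcd hv
    rw [length_pre, initSeg_pre (Nat.unpair_left_le _)] at h1
    rcases le_total m (Nat.find hex).unpair.1 with h | h
    · exact Option.some_injective _
        (h1.symm.trans (getElem?_eq_of_isPrefix (Φ.mono _ _ (pre_isPrefix b h)) hm))
    · exact Option.some_injective _
        ((getElem?_eq_of_isPrefix (Φ.mono _ _ (pre_isPrefix b h)) h1).symm.trans hm)
  subst hvy
  obtain ⟨n, hn, (h | h) | ⟨j, hj, hjB⟩⟩ := hC e (hyC (2 * e + 1)) _ hv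
  · rw [length_pre] at hn
    rw [initSeg_pre hn.le] at h
    exact Nat.find_min hex hn h
  · rw [length_pre] at hn
    rw [getD_pre hn] at h
    exact not_dominated_of_mem hRB hconv (hb n) h
  · rw [length_pre] at hn
    rw [getD_pre hn] at hj
    exact Nat.find_min (hne n) hj hjB

/-! ### Interleaving two families -/

/-- The family `A₀, D₀, A₁, D₁, …`. -/
def interleave (A D : ℕ → Set ℕ) (n : ℕ) : Set ℕ := if n % 2 = 0 then A (n / 2) else D (n / 2)

theorem sigma11_interleave {A D : ℕ → Set ℕ} (hA : Sigma11 fun p : ℕ × ℕ => p.2 ∈ A p.1)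
    (hD : Sigma11 fun p : ℕ × ℕ => p.2 ∈ D p.1) :
    Sigma11 fun p : ℕ × ℕ => p.2 ∈ interleave A D p.1 := by
  have hdiv : Computable fun p : ℕ × ℕ => (p.1 / 2, p.2) :=
    (Primrec.nat_div.to_comp.comp Computable.fst (Computable.const 2)).pair Computable.snd
  have hmod : Computable fun p : ℕ × ℕ => p.1 % 2 :=
    Primrec.nat_mod.to_comp.comp Computable.fst (Computable.const 2)
  have h := ((hA.comp hdiv).and
    (Primrec.beq.to_comp.comp hmod (Computable.const 0))).or ((hD.comp hdiv).and
    (Primrec.beq.to_comp.comp hmod (Computable.const 1)))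
  convert h using 2 with p
  rcases Nat.mod_two_eq_zero_or_one p.1 with h | h <;> simp [interleave, h]

theorem medvedevLE_interleave (A D : ℕ → Set ℕ) :
    MedvedevLE (homProd A) (homProd (interleave A D)) := by
  refine ⟨⟨fun σ => (List.range (σ.length / 2)).map fun i => σ.getD (2 * i) 0, ?_, ?_⟩, ?_⟩
  · refine computable_map_range (f := fun (σ : List ℕ) i => σ.getD (2 * i) 0) ?_ ?_
    · exact computable_getD.comp Computable.fst
        (Primrec.nat_double.to_comp.comp Computable.snd)
    · exact Primrec.nat_div.to_comp.comp Computable.list_length (Computable.const 2)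
  · rintro σ _ ⟨ρ, rfl⟩
    have h : σ.length / 2 ≤ (σ ++ ρ).length / 2 :=
      Nat.div_le_div_right (by simp)
    have h2 : ((List.range (σ.length / 2)).map fun i => σ.getD (2 * i) 0) =
        pre (fun i => (σ ++ ρ).getD (2 * i) 0) (σ.length / 2) := by
      refine List.map_congr_left fun i hi => ?_
      have := List.mem_range.1 hi
      rw [List.getD_append _ _ _ _ (by omega)]
    rw [h2]
    exact pre_isPrefix _ h
  · intro x hx
    refine ⟨fun n => x (2 * n), fun n => ?_, fun n => ⟨2 * n + 2, ?_⟩⟩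
    · simpa [interleave] using hx (2 * n)
    · have : ((List.range ((pre x (2 * n + 2)).length / 2)).map fun i =>
          (pre x (2 * n + 2)).getD (2 * i) 0) = pre (fun i => x (2 * i)) (n + 1) := by
        rw [length_pre, show (2 * n + 2) / 2 = n + 1 by omega]
        exact pre_congr (x := fun i => (pre x (2 * n + 2)).getD (2 * i) 0)
          fun i hi => getD_pre (by omega)
      exact (congrArg (·[n]?) this).trans (getElem?_pre n.lt_succ_self)

end UpwardDense

/-- The Medvedev degrees of homogeneous `Σ¹₁` sets with cofinite factors are
upward dense. -/
theorem cofinite_upward_dense :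
    ∀ B : ℕ → Set ℕ, UniformlySigma11 B → (∀ n, (B n)ᶜ.Finite) →
      ∃ C : ℕ → Set ℕ, UniformlySigma11 C ∧ (∀ n, (C n)ᶜ.Finite) ∧
        MedvedevLT (homProd B) (homProd C) := by
  rintro B ⟨R, hR, hRB⟩ hfin
  have hB : UpwardDense.Sigma11 fun p : ℕ × ℕ => p.2 ∈ B p.1 := ⟨R, hR, fun p => hRB p.1 p.2⟩
  obtain ⟨S, hS, hSC⟩ := UpwardDense.sigma11_interleave hB (UpwardDense.sigma11_diagSet hR hB)
  refine ⟨UpwardDense.interleave B (UpwardDense.diagSet R B),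
    ⟨S, hS, fun n m => hSC (n, m)⟩, fun n => ?_, UpwardDense.medvedevLE_interleave _ _,
    UpwardDense.not_medvedevLE_of_diagSet hRB (fun n => ?_) fun e => ?_⟩
  · unfold UpwardDense.interleave
    split_ifs
    · exact hfin _
    · exact UpwardDense.finite_compl_diagSet hRB hfin
  · exact Set.Infinite.nonempty (by simpa using (hfin n).infinite_compl)
  · rw [UpwardDense.interleave, if_neg (by omega), show (2 * e + 1) / 2 = e by omega]
end

section
/- For every nonempty homogeneous Σ¹₁ set A = ∏ₙAₙ in which each Aₙ is either nonempty and finite or cofinite, there exists a nonempty homogeneous Σ¹₁ set B such that B is not Medvedev reducible to A. -/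
open Set

namespace HomogeneousSigma11

/-! ### Initial segments -/

/-- The length-`k` initial segment of `x`, listed backwards. -/
def revPre (x : Baire) (k : ℕ) : List ℕ := (pre x k).reverse

lemma pre_zero (x : Baire) : pre x 0 = [] := rfl

lemma pre_succ (x : Baire) (k : ℕ) : pre x (k + 1) = pre x k ++ [x k] := by
  simp [pre, List.range_succ]

lemma pre_length (x : Baire) (k : ℕ) : (pre x k).length = k := by simp [pre]

lemma pre_take (x : Baire) {i k : ℕ} (h : i ≤ k) : (pre x k).take i = pre x i := by
  simp [pre, ← List.map_take, List.take_range, h]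

lemma pre_prefix (x : Baire) {i k : ℕ} (h : i ≤ k) : pre x i <+: pre x k := by
  rw [← pre_take x h]; exact List.take_prefix _ _

lemma pre_getD (x : Baire) {i k : ℕ} (h : i < k) : (pre x k).getD i 0 = x i := by
  simp [pre, List.getD, h]

lemma pre_congr {x y : Baire} {k : ℕ} (h : ∀ i < k, x i = y i) : pre x k = pre y k := by
  simpa [pre] using h

lemma revPre_succ (x : Baire) (k : ℕ) : revPre x (k + 1) = x k :: revPre x k := by
  simp [revPre, pre_succ]

lemma revPre_length (x : Baire) (k : ℕ) : (revPre x k).length = k := by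
  simp [revPre, pre_length]

lemma revPre_drop (x : Baire) {j k : ℕ} (h : j ≤ k) :
    (revPre x k).drop (k - j) = revPre x j := by
  induction k with
  | zero =>
    obtain rfl : j = 0 := by omega
    rfl
  | succ k ih =>
    rcases h.eq_or_lt with rfl | h'
    · simp
    · rw [Nat.succ_sub (by omega), revPre_succ, List.drop_succ_cons, ih (by omega)]

/-- Course-of-values recursion along initial segments. -/
lemma exists_forall_eq_apply_revPre (F : List ℕ → ℕ) :
    ∃ p : Baire, ∀ k, p k = F (revPre p k) := by
  let s : ℕ → List ℕ := fun k => Nat.rec [] (fun _ l => F l :: l) k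
  have hs : ∀ k, revPre (fun k => F (s k)) k = s k := by
    intro k
    induction k with
    | zero => rfl
    | succ k ih => rw [revPre_succ, ih]
  exact ⟨fun k => F (s k), fun k => by rw [hs]⟩

/-! ### Comparing trees by Lipschitz maps

Nodes are listed backwards, so that the children of `σ` are the lists `a :: σ`. -/

/-- The tree `T` has an infinite branch. -/
def HasPath (T : List ℕ → Prop) : Prop := ∃ p : Baire, ∀ k, T (revPre p k)

/-- The node of length `|σ| + 1` reached by the strategy `h` that moves first. -/
def imLt (h : List ℕ → ℕ) (σ : List ℕ) : List ℕ := σ.tails.map h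

/-- The node of length `|σ|` reached by the strategy `h` that moves second. -/
def imLe (h : List ℕ → ℕ) (σ : List ℕ) : List ℕ := (σ.tails.map h).dropLast

/-- The rank of `S` is less than that of `T`. -/
def Lt (S T : List ℕ → Prop) : Prop := ∃ h, ∀ σ, S σ → T (imLt h σ)

/-- The rank of `T` is at most that of `S`. -/
def Le (T S : List ℕ → Prop) : Prop := ∃ h, ∀ σ, T σ → S (imLe h σ)

lemma imLt_cons (h : List ℕ → ℕ) (a : ℕ) (σ : List ℕ) :
    imLt h (a :: σ) = h (a :: σ) :: imLt h σ := rfl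

lemma imLe_cons (h : List ℕ → ℕ) (a : ℕ) (σ : List ℕ) :
    imLe h (a :: σ) = h (a :: σ) :: imLe h σ := by
  cases σ <;> simp [imLe]

/-- Determinacy of the comparison game. -/
lemma lt_or_le {S T : List ℕ → Prop} (hS0 : S []) (hS : ∀ a σ, S (a :: σ) → S σ)
    (hT : ∀ a σ, T (a :: σ) → T σ) : Lt S T ∨ Le T S := by
  classical
  let L : List ℕ → List ℕ → Prop := fun τ σ => ∃ Z : List ℕ → List ℕ → Prop, Z τ σ ∧
    ∀ τ σ, Z τ σ → ∀ a, T (a :: τ) → ∃ b, S (b :: σ) ∧ Z (a :: τ) (b :: σ)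
  have L_step : ∀ τ σ, L τ σ → ∀ a, T (a :: τ) → ∃ b, S (b :: σ) ∧ L (a :: τ) (b :: σ) := by
    rintro τ σ ⟨Z, hZ, hcl⟩ a ha
    obtain ⟨b, hb, hb'⟩ := hcl τ σ hZ a ha
    exact ⟨b, hb, Z, hb', hcl⟩
  have not_L : ∀ τ σ, ¬ L τ σ → ∃ a, T (a :: τ) ∧ ∀ b, S (b :: σ) → ¬ L (a :: τ) (b :: σ) := by
    intro τ σ hn
    by_contra! hc
    refine hn ⟨fun τ' σ' => L τ' σ' ∨ (τ' = τ ∧ σ' = σ), Or.inr ⟨rfl, rfl⟩, ?_⟩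
    rintro τ' σ' (h | ⟨rfl, rfl⟩) a ha
    · obtain ⟨b, hb, hb'⟩ := L_step _ _ h a ha
      exact ⟨b, hb, Or.inl hb'⟩
    · obtain ⟨b, hb, hb'⟩ := hc a ha
      exact ⟨b, hb, Or.inl hb'⟩
  by_cases h0 : L [] []
  · right
    choose! b hbS hbL using L_step
    let G : List ℕ → List ℕ := fun τ => List.rec [] (fun a τ g => b τ g a :: g) τ
    have hG : ∀ τ, imLe (fun τ => (G τ).headI) τ = G τ := by
      intro τ
      induction τ with
      | nil => rfl
      | cons a τ ih => rw [imLe_cons, ih]; rfl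
    have key : ∀ τ, T τ → S (G τ) ∧ L τ (G τ) := by
      intro τ
      induction τ with
      | nil => exact fun _ => ⟨hS0, h0⟩
      | cons a τ ih =>
        intro h
        have hL := (ih (hT _ _ h)).2
        exact ⟨hbS _ _ hL _ h, hbL _ _ hL _ h⟩
    exact ⟨fun τ => (G τ).headI, fun τ h => by rw [hG]; exact (key τ h).1⟩
  · left
    choose! a haT haL using not_L
    let G : List ℕ → List ℕ := fun σ => List.rec [] (fun _ σ g => a g σ :: g) σ
    have hG : ∀ σ, imLt (fun σ => a (G σ) σ) σ = a (G σ) σ :: G σ := by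
      intro σ
      induction σ with
      | nil => rfl
      | cons b σ ih => rw [imLt_cons, ih]
    have key : ∀ σ, S σ → ¬ L (G σ) σ := by
      intro σ
      induction σ with
      | nil => exact fun _ => h0
      | cons b σ ih => exact fun h => haL _ _ (ih (hS _ _ h)) _ h
    exact ⟨fun σ => a (G σ) σ, fun σ h => by rw [hG]; exact haT _ _ (key σ h)⟩

lemma lt_of_hasPath (S : List ℕ → Prop) {T : List ℕ → Prop} (hT : HasPath T) : Lt S T := by
  obtain ⟨p, hp⟩ := hT
  have : ∀ σ : List ℕ, imLt (fun σ => p σ.length) σ = revPre p (σ.length + 1) := by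
    intro σ
    induction σ with
    | nil => rfl
    | cons a σ ih => rw [imLt_cons, ih, List.length_cons, ← revPre_succ]
  exact ⟨fun σ => p σ.length, fun σ _ => by rw [this]; exact hp _⟩

lemma le_of_hasPath (T : List ℕ → Prop) {S : List ℕ → Prop} (hS : HasPath S) : Le T S := by
  obtain ⟨p, hp⟩ := hS
  have : ∀ σ : List ℕ, imLe (fun σ => p (σ.length - 1)) σ = revPre p σ.length := by
    intro σ
    induction σ with
    | nil => rfl
    | cons a σ ih => rw [imLe_cons, ih, List.length_cons, revPre_succ]; rfl
  exact ⟨_, fun σ _ => by rw [this]; exact hp _⟩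

lemma Le.hasPath {T S : List ℕ → Prop} (h : Le T S) (hT : HasPath T) : HasPath S := by
  obtain ⟨h, hh⟩ := h
  obtain ⟨p, hp⟩ := hT
  have : ∀ k, imLe h (revPre p k) = revPre (fun k => h (revPre p (k + 1))) k := by
    intro k
    induction k with
    | zero => rfl
    | succ k ih =>
      rw [revPre_succ, imLe_cons, ih, ← revPre_succ, revPre_succ fun k => h (revPre p (k + 1))]
  exact ⟨_, fun k => this k ▸ hh _ (hp k)⟩

lemma imLt_revPre (h : List ℕ → ℕ) (p : Baire) (k : ℕ) :
    imLt h (revPre p k) = revPre (fun j => h (revPre p j)) (k + 1) := by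
  induction k with
  | zero => rfl
  | succ k ih => rw [revPre_succ, imLt_cons, ih, ← revPre_succ, revPre_succ _ (k + 1)]

lemma Lt.hasPath_of_self {T : List ℕ → Prop} (hT : T []) (h : Lt T T) : HasPath T := by
  obtain ⟨h, hh⟩ := h
  obtain ⟨p, hp⟩ := exists_forall_eq_apply_revPre h
  refine ⟨p, fun k => ?_⟩
  induction k with
  | zero => exact hT
  | succ k ih =>
    have := hh _ ih
    rwa [imLt_revPre, ← funext hp] at this

/-! ### Trees generated by a condition on nodes -/

/-- Every proper initial segment of `τ` satisfies `F`. -/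
def clo (F : List ℕ → Bool) (τ : List ℕ) : Bool :=
  decide (∀ i < τ.length, F (τ.take i) = true)

lemma clo_pre (F : List ℕ → Bool) (p : Baire) (k : ℕ) :
    clo F (pre p k) = true ↔ ∀ i < k, F (pre p i) = true := by
  simp only [clo, decide_eq_true_eq, pre_length]
  exact forall₂_congr fun i hi => by rw [pre_take p hi.le]

lemma clo_nil (F : List ℕ → Bool) : clo F [] = true := by simp [clo]

lemma forall_clo_pre (F : List ℕ → Bool) (p : Baire) :
    (∀ k, clo F (pre p k) = true) ↔ ∀ k, F (pre p k) = true := by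
  simp only [clo_pre]
  exact ⟨fun h k => h (k + 1) k (Nat.lt_succ_self k), fun h _ i _ => h i⟩

/-- The tree of nodes, listed backwards, all of whose proper initial segments satisfy `F`. -/
def tree (F : List ℕ → Bool) (σ : List ℕ) : Prop := clo F σ.reverse = true

lemma tree_nil (F : List ℕ → Bool) : tree F [] := clo_nil F

lemma tree_of_cons (F : List ℕ → Bool) (a : ℕ) (σ : List ℕ) (h : tree F (a :: σ)) :
    tree F σ := by
  simp only [tree, clo, decide_eq_true_eq, List.length_reverse, List.reverse_cons,
    List.length_cons, List.length_append] at h ⊢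
  intro i hi
  have := h i (by omega)
  rwa [List.take_append_of_le_length (by simpa using hi.le)] at this

lemma tree_revPre (F : List ℕ → Bool) (p : Baire) (k : ℕ) :
    tree F (revPre p k) ↔ ∀ i < k, F (pre p i) = true := by
  rw [tree, revPre, List.reverse_reverse, clo_pre]

lemma hasPath_tree (F : List ℕ → Bool) :
    HasPath (tree F) ↔ ∃ p : Baire, ∀ k, F (pre p k) = true := by
  simp only [HasPath, tree, revPre, List.reverse_reverse, forall_clo_pre]

lemma tree_lt_or_le (F G : List ℕ → Bool) : Lt (tree F) (tree G) ∨ Le (tree G) (tree F) :=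
  lt_or_le (tree_nil F) (tree_of_cons F) (tree_of_cons G)

/-! ### The diagonal set

`R` presents a uniformly `Σ¹₁` family, and `D e` reads the `e`-th functional at argument `e`. -/

section Diagonal

variable (R : ℕ × ℕ → List ℕ → Bool) (D : ℕ → List ℕ → Option ℕ)

/-- The condition generating the tree that searches for a point `z` of the product, together with
witnesses for its membership, such that `D e` is undefined along `z`. -/
def searchCond (e : ℕ) (τ : List ℕ) : Bool :=
  !(D e (τ.map fun a => a.unpair.1)).isSome &&
    clo (R (τ.length.unpair.1, (τ.map fun a => a.unpair.1).getD τ.length.unpair.1 0))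
      ((List.range τ.length.unpair.2).map
        fun j => (τ.getD (Nat.pair τ.length.unpair.1 j) 0).unpair.2)

/-- The conditions generating the search tree (index `0`) and the trees of the family. -/
def stageCond (e j : ℕ) : List ℕ → Bool :=
  Nat.casesOn j (searchCond R D e) fun j => R j.unpair

lemma stageCond_zero (e : ℕ) : stageCond R D e 0 = searchCond R D e := rfl

lemma stageCond_succ (e n m : ℕ) : stageCond R D e (Nat.pair n m + 1) = R (n, m) := by
  simp [stageCond]

/-- Along `z`, the functional `D e` never takes a value. -/
def Undef (e : ℕ) (z : Baire) : Prop := ∀ k, D e (pre z k) = none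

lemma map_fst_pre (p : Baire) (k : ℕ) :
    ((pre p k).map fun a => a.unpair.1) = pre (fun i => (p i).unpair.1) k := by
  simp [pre]

lemma searchCond_pre (e : ℕ) (p : Baire) (K : ℕ) :
    searchCond R D e (pre p K) = true ↔
      D e (pre (fun i => (p i).unpair.1) K) = none ∧
      clo (R (K.unpair.1, (p K.unpair.1).unpair.1))
        (pre (fun j => (p (Nat.pair K.unpair.1 j)).unpair.2) K.unpair.2) = true := by
  have h2 : ((List.range K.unpair.2).map
        fun j => ((pre p K).getD (Nat.pair K.unpair.1 j) 0).unpair.2) =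
      pre (fun j => (p (Nat.pair K.unpair.1 j)).unpair.2) K.unpair.2 := by
    refine List.map_congr_left fun j hj => ?_
    rw [pre_getD]
    conv_rhs => rw [← Nat.pair_unpair K]
    exact Nat.pair_lt_pair_right _ (List.mem_range.1 hj)
  rw [searchCond, pre_length, map_fst_pre, h2]
  rcases Nat.eq_zero_or_pos K.unpair.2 with h0 | h0
  · simp [h0, pre_zero, clo_nil]
  · have : K.unpair.1 < K := by
      conv_rhs => rw [← Nat.pair_unpair K]
      exact (Nat.left_le_pair _ 0).trans_lt (Nat.pair_lt_pair_right _ h0)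
    rw [pre_getD _ this]
    simp

lemma exists_undef_of_hasPath {e : ℕ} (h : HasPath (tree (stageCond R D e 0))) :
    ∃ z : Baire, (∀ n, HasPath (tree (R (n, z n)))) ∧ Undef D e z := by
  obtain ⟨p, hp⟩ := (hasPath_tree _).1 h
  simp only [stageCond_zero, searchCond_pre] at hp
  refine ⟨fun i => (p i).unpair.1, fun n => ?_, fun k => (hp k).1⟩
  rw [hasPath_tree]
  refine ⟨fun j => (p (Nat.pair n j)).unpair.2, (forall_clo_pre _ _).1 fun k => ?_⟩
  simpa using (hp (Nat.pair n k)).2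

/-- If the search tree has smaller rank than each of the trees at the coordinates of a point `z`
where `D e` is undefined, then the search tree has a branch. -/
lemma hasPath_of_undef {e : ℕ} {z : Baire} (hz : Undef D e z)
    (hlt : ∀ n, Lt (tree (stageCond R D e 0)) (tree (R (n, z n)))) :
    HasPath (tree (stageCond R D e 0)) := by
  choose h hh using hlt
  obtain ⟨p, hp⟩ := exists_forall_eq_apply_revPre fun τ =>
    Nat.pair (z τ.length)
      (h τ.length.unpair.1 (τ.drop (τ.length - τ.length.unpair.2)))
  have hp' : ∀ k, p k = Nat.pair (z k) (h k.unpair.1 (revPre p k.unpair.2)) := by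
    intro k
    rw [hp, revPre_length, revPre_drop p (Nat.unpair_right_le k)]
  refine (hasPath_tree _).2 ⟨p, fun K => ?_⟩
  induction K using Nat.strong_induction_on with
  | _ K ih =>
    rw [stageCond_zero, searchCond_pre]
    refine ⟨by simpa [hp'] using hz K, ?_⟩
    simp only [hp', Nat.unpair_pair]
    rcases hk : K.unpair.2 with _ | k
    · rw [pre_zero, clo_nil]
    · have hkK : k + 1 ≤ K := hk ▸ Nat.unpair_right_le K
      have := hh K.unpair.1 (revPre p k) ((tree_revPre _ _ _).2 fun i hi => ih i (by omega))
      rw [imLt_revPre, tree, revPre, List.reverse_reverse] at this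
      exact this

/-- The tree at the position `t` of the list `s` of indices. -/
abbrev stage (e : ℕ) (s : List ℕ) (t : ℕ) : List ℕ → Prop :=
  tree (stageCond R D e (s.getD t 0))

/-- `z` is the leftmost point of the approximation to the product given by the stages in `s`. -/
structure Approx (e : ℕ) (s : List ℕ) (z : Baire) : Prop where
  lt : ∀ n t, Lt (stage R D e s t) (tree (R (n, z n)))
  le : ∀ n m, m < z n → ∃ t, Le (tree (R (n, m))) (stage R D e s t)

/-- The values that are not the value of `D e` at the approximation for each list `s`. -/
def diag (e : ℕ) : Set ℕ :=
  {v | ∀ s : List ℕ, ∃ z, Approx R D e s z ∧ ∀ k, D e (pre z k) ≠ some v}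

lemma exists_approx_le (e : ℕ) (s : List ℕ) {x : Baire}
    (hx : ∀ n, HasPath (tree (R (n, x n)))) :
    ∃ z, Approx R D e s z ∧ ∀ n, z n ≤ x n := by
  classical
  have hex : ∀ n, ∃ m, ∀ t, Lt (stage R D e s t) (tree (R (n, m))) :=
    fun n => ⟨x n, fun t => lt_of_hasPath _ (hx n)⟩
  refine ⟨fun n => Nat.find (hex n), ⟨fun n => Nat.find_spec (hex n), fun n m hm => ?_⟩,
    fun n => Nat.find_min' _ fun t => lt_of_hasPath _ (hx n)⟩
  obtain ⟨t, ht⟩ := not_forall.1 (Nat.find_min (hex n) hm)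
  exact ⟨t, (tree_lt_or_le _ _).resolve_left ht⟩

/-- A functional that is total on a product of finite sets takes finitely many values there. -/
lemma finite_values {d : List ℕ → Option ℕ}
    (hd : ∀ (x : Baire) k k' v v', d (pre x k) = some v → d (pre x k') = some v' → v = v')
    {K : ℕ → Set ℕ} (hK : ∀ n, (K n).Finite)
    (htot : ∀ z : Baire, (∀ n, z n ∈ K n) → ∃ k v, d (pre z k) = some v) :
    {v | ∃ z : Baire, (∀ n, z n ∈ K n) ∧ ∃ k, d (pre z k) = some v}.Finite := by
  have hcpt : IsCompact (Set.univ.pi K : Set Baire) :=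
    isCompact_univ_pi fun n => (hK n).isCompact
  have hopen : ∀ v, IsOpen {z : Baire | ∃ k, d (pre z k) = some v} := by
    intro v
    have : {z : Baire | ∃ k, d (pre z k) = some v} = ⋃ k, {z : Baire | d (pre z k) = some v} := by
      ext; simp
    rw [this]
    refine isOpen_iUnion fun k => ?_
    have hc : Continuous fun z : Baire => fun i : Fin k => z i := by fun_prop
    have hpre : ∀ z : Baire, pre z k = List.ofFn fun i : Fin k => z i := by
      intro z
      refine List.ext_getElem (by simp [pre]) fun i h1 h2 => by simp [pre]
    simp only [hpre]
    exact (isOpen_discrete {w : Fin k → ℕ | d (List.ofFn w) = some v}).preimage hc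
  obtain ⟨t, ht⟩ := hcpt.elim_finite_subcover _ hopen fun z hz => by
    obtain ⟨k, v, h⟩ := htot z fun n => hz n trivial
    exact Set.mem_iUnion.2 ⟨v, k, h⟩
  refine t.finite_toSet.subset ?_
  rintro v ⟨z, hz, k, hk⟩
  obtain ⟨v', hv', k', hk'⟩ := by simpa using ht fun n _ => hz n
  exact hd z k k' v v' hk hk' ▸ hv'

lemma diag_nonempty {e : ℕ}
    (hd : ∀ (x : Baire) k k' v v', D e (pre x k) = some v → D e (pre x k') = some v' → v = v')
    {x : Baire} (hx : ∀ n, HasPath (tree (R (n, x n)))) : (diag R D e).Nonempty := by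
  by_cases hY : HasPath (tree (stageCond R D e 0))
  · obtain ⟨z, hz, hu⟩ := exists_undef_of_hasPath R D hY
    refine ⟨0, fun s => ⟨z, ⟨fun n t => lt_of_hasPath _ (hz n), fun n m _ => ?_⟩,
      fun k => by simp [hu k]⟩⟩
    refine ⟨s.length, ?_⟩
    rw [stage, List.getD_eq_default _ _ le_rfl]
    exact le_of_hasPath _ hY
  · have hfin := finite_values (d := D e) hd
      (K := fun n => {m | m ≤ x n ∧ Lt (tree (stageCond R D e 0)) (tree (R (n, m)))})
      (fun n => (Set.finite_Iic (x n)).subset fun m hm => hm.1) fun z hz => by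
        by_contra! hu
        exact hY (hasPath_of_undef R D (z := z)
          (fun k => Option.eq_none_iff_forall_ne_some.2 (hu k)) fun n => (hz n).2)
    obtain ⟨v, hv⟩ := hfin.exists_notMem
    refine ⟨v, fun s => ?_⟩
    obtain ⟨z, hz, hle⟩ := exists_approx_le R D e s hx
    refine ⟨z, hz, fun k hk => hv ⟨z, fun n => ⟨hle n, ?_⟩, k, hk⟩⟩
    have := hz.lt n s.length
    rwa [stage, List.getD_eq_default _ _ le_rfl] at this

/-- If `D e` is total on the product, its value at the leftmost point is not in `diag R D e`. -/
lemma exists_notMem_diag {e : ℕ} {x : Baire}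
    (hx : ∀ n, HasPath (tree (R (n, x n))))
    (hmin : ∀ n, ∀ m < x n, ¬ HasPath (tree (R (n, m))))
    (htot : ∀ z : Baire, (∀ n, HasPath (tree (R (n, z n)))) → ¬ Undef D e z)
    {k v : ℕ} (hk : D e (pre x k) = some v) : v ∉ diag R D e := by
  intro hv
  have hY : ¬ HasPath (tree (stageCond R D e 0)) := fun h => by
    obtain ⟨z, hz, hu⟩ := exists_undef_of_hasPath R D h
    exact htot z hz hu
  let s : List ℕ :=
    (List.range k).flatMap fun n => (List.range (x n)).map fun m => Nat.pair n m + 1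
  have hs : ∀ t, ¬ HasPath (stage R D e s t) := by
    intro t
    rcases lt_or_ge t s.length with ht | ht
    · have hmem : s.getD t 0 ∈ s := by
        rw [List.getD_eq_getElem _ _ ht]; exact List.getElem_mem ht
      obtain ⟨n, -, hn⟩ := List.mem_flatMap.1 hmem
      obtain ⟨m, hm, hnm⟩ := List.mem_map.1 hn
      rw [stage, ← hnm, stageCond_succ]
      exact hmin n m (List.mem_range.1 hm)
    · rwa [stage, List.getD_eq_default _ _ ht]
  obtain ⟨z, hz, hne⟩ := hv s
  refine hne k ?_
  rw [← hk, pre_congr (x := z) (y := x)]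
  intro n hn
  rcases lt_trichotomy (z n) (x n) with h | h | h
  · have hmem : Nat.pair n (z n) + 1 ∈ s :=
      List.mem_flatMap.2 ⟨n, List.mem_range.2 hn, List.mem_map.2 ⟨z n, List.mem_range.2 h, rfl⟩⟩
    obtain ⟨t, ht, hst⟩ := List.getElem_of_mem hmem
    have hlt := hz.lt n t
    rw [stage, List.getD_eq_getElem _ _ ht, hst, stageCond_succ] at hlt
    exact (hmin n _ h (hlt.hasPath_of_self (tree_nil _))).elim
  · exact h
  · obtain ⟨t, ht⟩ := hz.le n _ h
    exact (hs t (ht.hasPath (hx n))).elim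

end Diagonal

/-! ### Reading off values of functionals -/

section Functional

open Nat.Partrec (Code)
open Encodable

/-- The value at argument `e` of the functional with code `e`, as found by the search step
that the length of `τ` stands for. -/
def readStep (e : ℕ) (τ : List ℕ) : Option ℕ :=
  (Code.evaln τ.length.unpair.2 (Denumerable.ofNat Code e)
    (encode (τ.take τ.length.unpair.1))).bind fun w =>
      (decode w : Option (List ℕ)).bind fun l => l[e]?

/-- The first value at argument `e` of the functional with code `e` found along `τ`. -/
def readFirst (e : ℕ) (τ : List ℕ) : Option ℕ :=
  Nat.rec none (fun i acc => acc <|> readStep e (τ.take i)) τ.length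

lemma computable₂_readStep : Computable₂ readStep := by
  have hlen : Primrec fun p : ℕ × List ℕ => p.2.length.unpair :=
    Primrec.unpair.comp (Primrec.list_length.comp Primrec.snd)
  have hev : Primrec fun p : ℕ × List ℕ =>
      Code.evaln p.2.length.unpair.2 (Denumerable.ofNat Code p.1)
        (encode (p.2.take p.2.length.unpair.1)) :=
    Code.primrec_evaln.comp <| Primrec.pair
      (Primrec.pair (Primrec.snd.comp hlen) ((Primrec.ofNat Code).comp Primrec.fst))
      (Primrec.encode.comp (Primrec.list_take.comp (Primrec.fst.comp hlen) Primrec.snd))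
  have : Primrec₂ readStep :=
    Primrec.option_bind hev <| Primrec.option_bind (Primrec.decode.comp Primrec.snd)
      (Primrec.list_getElem?.comp Primrec.snd (Primrec.fst.comp (Primrec.fst.comp Primrec.fst)))
  exact this.to_comp

lemma computable₂_readFirst : Computable₂ readFirst := by
  refine Computable.nat_rec (f := fun p : ℕ × List ℕ => p.2.length)
    (g := fun _ => none) (h := fun p q => q.2 <|> readStep p.1 (p.2.take q.1))
    (Computable.list_length.comp Computable.snd) (Computable.const none) ?_
  exact Primrec.option_orElse.to_comp.comp (Computable.snd.comp Computable.snd)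
    (computable₂_readStep.comp (Computable.fst.comp Computable.fst)
      (Primrec.list_take.to_comp.comp (Computable.fst.comp Computable.snd)
        (Computable.snd.comp Computable.fst)))

lemma readFirst_pre (e : ℕ) (x : Baire) (k : ℕ) :
    readFirst e (pre x k) = Nat.rec none (fun i acc => acc <|> readStep e (pre x i)) k := by
  rw [readFirst, pre_length]
  suffices ∀ j ≤ k, (Nat.rec none (fun i acc => acc <|> readStep e ((pre x k).take i)) j :
      Option ℕ) = Nat.rec none (fun i acc => acc <|> readStep e (pre x i)) j from this k le_rfl
  intro j
  induction j with
  | zero => exact fun _ => rfl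
  | succ j ih => intro hj; simp only [ih (by omega), pre_take x (show j ≤ k by omega)]

lemma readFirst_pre_succ (e : ℕ) (x : Baire) (k : ℕ) :
    readFirst e (pre x (k + 1)) = (readFirst e (pre x k) <|> readStep e (pre x k)) := by
  rw [readFirst_pre, readFirst_pre]

lemma readFirst_pre_mono {e : ℕ} {x : Baire} {k k' v : ℕ} (h : k ≤ k')
    (hk : readFirst e (pre x k) = some v) : readFirst e (pre x k') = some v := by
  induction k', h using Nat.le_induction with
  | base => exact hk
  | succ k' _ ih => rw [readFirst_pre_succ, ih]; rfl

lemma readFirst_pre_unique (e : ℕ) (x : Baire) (k k' v v' : ℕ)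
    (hk : readFirst e (pre x k) = some v) (hk' : readFirst e (pre x k') = some v') : v = v' := by
  have h1 := readFirst_pre_mono (le_max_left k k') hk
  have h2 := readFirst_pre_mono (le_max_right k k') hk'
  exact Option.some_injective _ (h1.symm.trans h2)

lemma getElem?_eq_some_of_prefix {l₁ l₂ : List ℕ} (h : l₁ <+: l₂) {i u : ℕ}
    (hu : l₁[i]? = some u) : l₂[i]? = some u := by
  obtain ⟨t, rfl⟩ := h
  rw [List.getElem?_append_left (List.getElem?_eq_some_iff.1 hu).1, hu]

lemma exists_readFirst_eq (Φ : TuringFunctional) :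
    ∃ e, ∀ x y, Φ.Eval x y → ∃ k, readFirst e (pre x k) = some (y e) := by
  obtain ⟨c, hc⟩ := Code.exists_code.1 Φ.computable
  have hev : ∀ σ, Code.eval c (encode σ) = Part.some (encode (Φ.φ σ)) := by
    intro σ
    simp [hc]
  have hsound : ∀ x y, Φ.Eval x y → ∀ k v, readStep (encode c) (pre x k) = some v →
      v = y (encode c) := by
    intro x y hxy k v hv
    obtain ⟨w, hw, hv⟩ := Option.bind_eq_some_iff.1 hv
    rw [Denumerable.ofNat_encode] at hw
    have hw' := Code.evaln_sound hw
    rw [hev, Part.mem_some_iff] at hw'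
    rw [hw', encodek, Option.bind_some, pre_length, pre_take x (Nat.unpair_left_le k)] at hv
    obtain ⟨m, hm⟩ := hxy (encode c)
    have key : ∀ i, ∀ {u}, (Φ.φ (pre x i))[encode c]? = some u →
        (Φ.φ (pre x (max i m)))[encode c]? = some u := fun i u hu =>
      getElem?_eq_some_of_prefix (Φ.mono _ _ (pre_prefix x (le_max_left i m))) hu
    have h1 := key _ hv
    have h2 : (Φ.φ (pre x (max k.unpair.1 m)))[encode c]? = some (y (encode c)) :=
      getElem?_eq_some_of_prefix (Φ.mono _ _ (pre_prefix x (le_max_right _ m))) hm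
    exact Option.some_injective _ (h1.symm.trans h2)
  have hsound' : ∀ x y, Φ.Eval x y → ∀ k v, readFirst (encode c) (pre x k) = some v →
      v = y (encode c) := by
    intro x y hxy k
    induction k with
    | zero => intro v hv; rw [readFirst_pre] at hv; cases hv
    | succ k ih =>
      intro v hv
      rw [readFirst_pre_succ] at hv
      rcases h : readFirst (encode c) (pre x k) with _ | u
      · rw [h] at hv
        exact hsound x y hxy k v hv
      · rw [h] at hv
        exact ih v (h.trans hv)
  refine ⟨encode c, fun x y hxy => ?_⟩
  obtain ⟨m, hm⟩ := hxy (encode c)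
  obtain ⟨s, hs⟩ := Code.evaln_complete.1
    (show encode (Φ.φ (pre x m)) ∈ Code.eval c (encode (pre x m)) by simp [hev])
  have hstep : readStep (encode c) (pre x (Nat.pair m s)) = some (y (encode c)) := by
    rw [readStep, Denumerable.ofNat_encode, pre_length, Nat.unpair_pair,
      pre_take x (Nat.left_le_pair m s), Option.mem_def.1 hs]
    simpa using hm
  refine ⟨Nat.pair m s + 1, ?_⟩
  rcases h : readFirst (encode c) (pre x (Nat.pair m s + 1)) with _ | v
  · rw [readFirst_pre_succ, hstep] at h
    cases h' : readFirst (encode c) (pre x (Nat.pair m s)) <;> simp [h'] at h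
  · rw [hsound' x y hxy _ v h]

end Functional

/-! ### Computability of the diagonal set -/

section Definability

open Encodable

variable {α β : Type} [Primcodable α] [Primcodable β]

/-- A lightface `Π⁰₁` relation between codes and points of Baire space. -/
def IsPi01 (P : α → Baire → Prop) : Prop :=
  ∃ R : α → List ℕ → Bool, Computable₂ R ∧ ∀ a y, P a y ↔ ∀ k, R a (pre y k) = true

lemma IsPi01.and {P Q : α → Baire → Prop} (hP : IsPi01 P) (hQ : IsPi01 Q) :
    IsPi01 fun a y => P a y ∧ Q a y := by
  obtain ⟨R, hR, h⟩ := hP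
  obtain ⟨S, hS, h'⟩ := hQ
  refine ⟨fun a τ => R a τ && S a τ, Primrec.and.to_comp.comp hR hS, fun a y => ?_⟩
  simp [h, h', forall_and]

/-- A universal quantifier over codes in front of a computable condition on computably many
values of `y` gives a `Π⁰₁` relation. -/
lemma isPi01_forall_map {M : α × β → List ℕ → Bool} {l : α × β → List ℕ}
    (hM : Computable₂ M) (hl : Primrec l) :
    IsPi01 fun a y => ∀ b, M (a, b) ((l (a, b)).map y) = true := by
  have hlen : Primrec fun p : (α × List ℕ) × β => p.1.2.length :=
    Primrec.list_length.comp (Primrec.snd.comp Primrec.fst)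
  have hl' : Primrec fun p : (α × List ℕ) × β => l (p.1.1, p.2) :=
    hl.comp (Primrec.pair (Primrec.fst.comp Primrec.fst) Primrec.snd)
  have hdec : Primrec fun p : (α × List ℕ) × β =>
      decide (∀ i ∈ l (p.1.1, p.2), i < p.1.2.length) :=
    ((PrimrecRel.forall_mem_list Primrec.nat_lt).comp hl' hlen).decide
  have hmap : Primrec fun p : (α × List ℕ) × β =>
      (l (p.1.1, p.2)).map fun i => p.1.2.getD i 0 :=
    Primrec.list_map hl' ((Primrec.list_getD 0).comp
      (Primrec.snd.comp (Primrec.fst.comp Primrec.fst)) Primrec.snd)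
  have hbody : Computable fun p : (α × List ℕ) × β =>
      cond (decide (∀ i ∈ l (p.1.1, p.2), i < p.1.2.length))
        (M (p.1.1, p.2) ((l (p.1.1, p.2)).map fun i => p.1.2.getD i 0)) true :=
    Computable.cond hdec.to_comp
      (hM.comp (Computable.pair (Computable.fst.comp Computable.fst) Computable.snd)
        hmap.to_comp) (Computable.const true)
  refine ⟨fun a τ => Option.casesOn (decode τ.length.unpair.1 : Option β) true fun b =>
      cond (decide (∀ i ∈ l (a, b), i < τ.length))
        (M (a, b) ((l (a, b)).map fun i => τ.getD i 0)) true, ?_, fun a y => ?_⟩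
  · exact Computable.option_casesOn
      (o := fun p : α × List ℕ => (decode p.2.length.unpair.1 : Option β))
      (Computable.decode.comp (Computable.fst.comp
        (Computable.unpair.comp (Computable.list_length.comp Computable.snd))))
      (Computable.const true) hbody
  · have hval : ∀ b k, (∀ i ∈ l (a, b), i < k) →
        ((l (a, b)).map fun i => (pre y k).getD i 0) = (l (a, b)).map y := fun b k h =>
      List.map_congr_left fun i hi => pre_getD y (h i hi)
    constructor
    · intro h k
      beta_reduce
      rw [pre_length]
      rcases (decode k.unpair.1 : Option β) with _ | b
      · rfl
      · by_cases hb : ∀ i ∈ l (a, b), i < k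
        · simp only [hval b k hb, h b, Bool.cond_self]
        · simp [hb]
    · intro h b
      obtain ⟨c, hc⟩ : ∃ c, ∀ i ∈ l (a, b), i < c :=
        ⟨(l (a, b)).sum + 1, fun i hi => Nat.lt_succ_of_le (List.le_sum_of_mem hi)⟩
      have hk : ∀ i ∈ l (a, b), i < Nat.pair (encode b) c := fun i hi =>
        (hc i hi).trans_le (Nat.right_le_pair _ _)
      have := h (Nat.pair (encode b) c)
      beta_reduce at this
      rw [pre_length, Nat.unpair_pair] at this
      simpa only [encodek, hval b _ hk, decide_eq_true hk, cond_true] using this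

lemma computable₂_clo {F : α → List ℕ → Bool} (hF : Computable₂ F) :
    Computable₂ fun a τ => clo (F a) τ := by
  have : Computable fun p : α × List ℕ =>
      (Nat.rec true (fun i acc => acc && F p.1 (p.2.take i)) p.2.length : Bool) :=
    Computable.nat_rec (h := fun (p : α × List ℕ) (q : ℕ × Bool) => q.2 && F p.1 (p.2.take q.1))
      (Computable.list_length.comp Computable.snd) (Computable.const true)
      (Primrec.and.to_comp.comp (Computable.snd.comp Computable.snd)
        (hF.comp (Computable.fst.comp Computable.fst)
          (Primrec.list_take.to_comp.comp (Computable.fst.comp Computable.snd)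
            (Computable.snd.comp Computable.fst))))
  refine this.of_eq fun ⟨a, τ⟩ => ?_
  have key : ∀ n, (Nat.rec true (fun i acc => acc && F a (τ.take i)) n : Bool) =
      decide (∀ i < n, F a (τ.take i) = true) := by
    intro n
    induction n with
    | zero => simp
    | succ n ih => simp only [ih, Nat.forall_lt_succ_right, Bool.decide_and, Bool.decide_eq_true]
  exact key _

lemma computable_clo_comp {γ : Type} [Primcodable γ] {F : α → List ℕ → Bool}
    (hF : Computable₂ F) {f : γ → α} {g : γ → List ℕ} (hf : Computable f) (hg : Computable g) :
    Computable fun c => clo (F (f c)) (g c) :=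
  (computable₂_clo hF).comp hf hg

lemma primrec_tails : Primrec (List.tails : List ℕ → List (List ℕ)) := by
  have : Primrec fun σ : List ℕ => (List.range (σ.length + 1)).map fun i => σ.drop i :=
    Primrec.list_map (Primrec.list_range.comp (Primrec.succ.comp Primrec.list_length))
      (Primrec.list_drop.comp Primrec.snd Primrec.fst)
  refine this.of_eq fun σ => ?_
  induction σ with
  | nil => rfl
  | cons a σ ih =>
    rw [List.length_cons, List.range_succ_eq_map, List.tails_cons, ← ih]
    simp [Function.comp_def]

variable {R : ℕ × ℕ → List ℕ → Bool} {D : ℕ → List ℕ → Option ℕ}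

lemma computable₂_searchCond (hR : Computable₂ R) (hD : Computable₂ D) :
    Computable₂ (searchCond R D) := by
  have hlen : Primrec fun p : ℕ × List ℕ => p.2.length.unpair :=
    Primrec.unpair.comp (Primrec.list_length.comp Primrec.snd)
  have hmap : Primrec fun p : ℕ × List ℕ => p.2.map fun a => a.unpair.1 :=
    Primrec.list_map Primrec.snd (Primrec.fst.comp (Primrec.unpair.comp Primrec.snd))
  have hget : Primrec fun p : ℕ × List ℕ =>
      (p.2.map fun a => a.unpair.1).getD p.2.length.unpair.1 0 :=
    (Primrec.list_getD 0).comp hmap (Primrec.fst.comp hlen)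
  have hcol : Primrec fun p : ℕ × List ℕ => (List.range p.2.length.unpair.2).map
      fun j => (p.2.getD (Nat.pair p.2.length.unpair.1 j) 0).unpair.2 :=
    Primrec.list_map (Primrec.list_range.comp (Primrec.snd.comp hlen)) <|
      Primrec.snd.comp <| Primrec.unpair.comp <|
        (Primrec.list_getD 0).comp (Primrec.snd.comp Primrec.fst)
          (Primrec₂.natPair.comp (Primrec.fst.comp (hlen.comp Primrec.fst)) Primrec.snd)
  exact Primrec.and.to_comp.comp
    ((Primrec.not.comp Primrec.option_isSome).to_comp.comp
      (hD.comp Computable.fst hmap.to_comp))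
    ((computable₂_clo hR).comp
      (Computable.pair (Primrec.fst.comp hlen).to_comp hget.to_comp) hcol.to_comp)

lemma computable₂_stageCond (hR : Computable₂ R) (hD : Computable₂ D) :
    Computable₂ fun q : ℕ × ℕ => stageCond R D q.1 q.2 := by
  have : Computable fun p : (ℕ × ℕ) × List ℕ =>
      (Nat.casesOn p.1.2 (searchCond R D p.1.1 p.2) fun j => R j.unpair p.2 : Bool) :=
    Computable.nat_casesOn (Computable.snd.comp Computable.fst)
      ((computable₂_searchCond hR hD).comp (Computable.fst.comp Computable.fst) Computable.snd)
      (hR.comp (Computable.unpair.comp Computable.snd) (Computable.snd.comp Computable.fst))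
  refine this.of_eq fun ⟨⟨e, j⟩, τ⟩ => ?_
  cases j <;> rfl

/-- The argument at which a witness for membership in the diagonal set stores the value at
`(s, n, t, σ)` of its `i`-th component. -/
def slot (i : ℕ) (s : List ℕ) (n t : ℕ) (σ : List ℕ) : ℕ := encode (i, s, n, t, σ)

lemma primrec_slot {γ : Type} [Primcodable γ] (i : ℕ) {s : γ → List ℕ} {n t : γ → ℕ}
    {σ : γ → List ℕ} (hs : Primrec s) (hn : Primrec n) (ht : Primrec t) (hσ : Primrec σ) :
    Primrec fun c => slot i (s c) (n c) (t c) (σ c) :=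
  Primrec.encode.comp <| Primrec.pair (Primrec.const i) <| hs.pair <| hn.pair <| ht.pair hσ

/-- Four families can be stored in a single point of Baire space. -/
lemma exists_slot_eq (f : ℕ → List ℕ → ℕ → ℕ → List ℕ → ℕ) :
    ∃ y : Baire, ∀ i s n t σ, y (slot i s n t σ) = f i s n t σ := by
  refine ⟨fun j => ((decode j : Option (ℕ × List ℕ × ℕ × ℕ × List ℕ)).map
    fun c => f c.1 c.2.1 c.2.2.1 c.2.2.2.1 c.2.2.2.2).getD 0, fun i s n t σ => ?_⟩
  simp [slot]

/-- The parameters of a condition on witnesses: a pair `(e, v)` and a tuple `(s, n, t, σ)`. -/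
abbrev Param : Type := (ℕ × ℕ) × (List ℕ × ℕ × ℕ × List ℕ)

lemma primrec_list : Primrec fun p : Param => p.2.1 := Primrec.fst.comp Primrec.snd

lemma primrec_coord : Primrec fun p : Param => p.2.2.1 :=
  Primrec.fst.comp (Primrec.snd.comp Primrec.snd)

lemma primrec_pos : Primrec fun p : Param => p.2.2.2.1 :=
  Primrec.fst.comp (Primrec.snd.comp (Primrec.snd.comp Primrec.snd))

lemma primrec_node : Primrec fun p : Param => p.2.2.2.2 :=
  Primrec.snd.comp (Primrec.snd.comp (Primrec.snd.comp Primrec.snd))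

/-- The stored maps witness that the stages have smaller rank. -/
lemma isPi01_lt (hR : Computable₂ R) (hD : Computable₂ D) :
    IsPi01 fun (a : ℕ × ℕ) (y : Baire) => ∀ s n t σ, stage R D a.1 s t σ →
      tree (R (n, y (slot 0 s n 0 []))) (imLt (fun ρ => y (slot 1 s n t ρ)) σ) := by
  have hl : Primrec fun p : Param => slot 0 p.2.1 p.2.2.1 0 [] ::
      p.2.2.2.2.tails.map fun ρ => slot 1 p.2.1 p.2.2.1 p.2.2.2.1 ρ :=
    Primrec.list_cons.comp
      (primrec_slot 0 primrec_list primrec_coord (Primrec.const 0) (Primrec.const []))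
      (Primrec.list_map (primrec_tails.comp primrec_node)
        (primrec_slot 1 (primrec_list.comp Primrec.fst) (primrec_coord.comp Primrec.fst)
          (primrec_pos.comp Primrec.fst) Primrec.snd))
  have hM : Computable₂ fun (p : Param) (L : List ℕ) =>
      !clo (stageCond R D p.1.1 (p.2.1.getD p.2.2.2.1 0)) p.2.2.2.2.reverse ||
        clo (R (p.2.2.1, L.headI)) L.tail.reverse := by
    refine Primrec.or.to_comp.comp (Primrec.not.to_comp.comp ?_) ?_
    · have hf : Computable fun q : Param × List ℕ => (q.1.1.1, q.1.2.1.getD q.1.2.2.2.1 0) :=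
        (Primrec.pair (Primrec.fst.comp (Primrec.fst.comp Primrec.fst))
          ((Primrec.list_getD 0).comp (primrec_list.comp Primrec.fst)
            (primrec_pos.comp Primrec.fst))).to_comp
      have hg : Computable fun q : Param × List ℕ => q.1.2.2.2.2.reverse :=
        (Primrec.list_reverse.comp (primrec_node.comp Primrec.fst)).to_comp
      have := computable_clo_comp (computable₂_stageCond hR hD) hf hg
      exact this
    · have hf : Computable fun q : Param × List ℕ => (q.1.2.2.1, q.2.headI) :=
        (Primrec.pair (primrec_coord.comp Primrec.fst)
          (Primrec.list_headI.comp Primrec.snd)).to_comp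
      have hg : Computable fun q : Param × List ℕ => q.2.tail.reverse :=
        (Primrec.list_reverse.comp (Primrec.list_tail.comp Primrec.snd)).to_comp
      exact computable_clo_comp hR hf hg
  obtain ⟨S, hS, h⟩ := isPi01_forall_map hM hl
  refine ⟨S, hS, fun a y => Iff.trans ?_ (h a y)⟩
  simp [Prod.forall, tree, imLt, Function.comp_def, imp_iff_not_or]

/-- The stored maps witness that the stages have rank at least that of the trees to the left. -/
lemma isPi01_le (hR : Computable₂ R) (hD : Computable₂ D) :
    IsPi01 fun (a : ℕ × ℕ) (y : Baire) => ∀ s n m σ, m < y (slot 0 s n 0 []) →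
      tree (R (n, m)) σ →
        stage R D a.1 s (y (slot 2 s n m [])) (imLe (fun ρ => y (slot 3 s n m ρ)) σ) := by
  have hl : Primrec fun p : Param => slot 0 p.2.1 p.2.2.1 0 [] ::
      slot 2 p.2.1 p.2.2.1 p.2.2.2.1 [] ::
      p.2.2.2.2.tails.map fun ρ => slot 3 p.2.1 p.2.2.1 p.2.2.2.1 ρ :=
    Primrec.list_cons.comp
      (primrec_slot 0 primrec_list primrec_coord (Primrec.const 0) (Primrec.const [])) <|
    Primrec.list_cons.comp
      (primrec_slot 2 primrec_list primrec_coord primrec_pos (Primrec.const []))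
      (Primrec.list_map (primrec_tails.comp primrec_node)
        (primrec_slot 3 (primrec_list.comp Primrec.fst) (primrec_coord.comp Primrec.fst)
          (primrec_pos.comp Primrec.fst) Primrec.snd))
  have hM : Computable₂ fun (p : Param) (L : List ℕ) =>
      !decide (p.2.2.2.1 < L.headI) || (!clo (R (p.2.2.1, p.2.2.2.1)) p.2.2.2.2.reverse ||
        clo (stageCond R D p.1.1 (p.2.1.getD L.tail.headI 0)) L.tail.tail.reverse.tail) := by
    refine Primrec.or.to_comp.comp ?_ (Primrec.or.to_comp.comp (Primrec.not.to_comp.comp ?_) ?_)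
    · exact (Primrec.not.comp (Primrec.nat_lt.comp (primrec_pos.comp Primrec.fst)
        (Primrec.list_headI.comp Primrec.snd)).decide).to_comp
    · have hf : Computable fun q : Param × List ℕ => (q.1.2.2.1, q.1.2.2.2.1) :=
        (Primrec.pair (primrec_coord.comp Primrec.fst)
          (primrec_pos.comp Primrec.fst)).to_comp
      have hg : Computable fun q : Param × List ℕ => q.1.2.2.2.2.reverse :=
        (Primrec.list_reverse.comp (primrec_node.comp Primrec.fst)).to_comp
      exact computable_clo_comp hR hf hg
    · have hf : Computable fun q : Param × List ℕ => (q.1.1.1, q.1.2.1.getD q.2.tail.headI 0) :=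
        (Primrec.pair (Primrec.fst.comp (Primrec.fst.comp Primrec.fst))
          ((Primrec.list_getD 0).comp (primrec_list.comp Primrec.fst)
            (Primrec.list_headI.comp (Primrec.list_tail.comp Primrec.snd)))).to_comp
      have hg : Computable fun q : Param × List ℕ => q.2.tail.tail.reverse.tail :=
        (Primrec.list_tail.comp (Primrec.list_reverse.comp
          (Primrec.list_tail.comp (Primrec.list_tail.comp Primrec.snd)))).to_comp
      have := computable_clo_comp (computable₂_stageCond hR hD) hf hg
      exact this
  obtain ⟨S, hS, h⟩ := isPi01_forall_map hM hl
  refine ⟨S, hS, fun a y => Iff.trans ?_ (h a y)⟩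
  simp [Prod.forall, tree, imLe, Function.comp_def, imp_iff_not_or]

/-- The value `v` is not that of `D e` at the stored points. -/
lemma isPi01_ne (hD : Computable₂ D) :
    IsPi01 fun (a : ℕ × ℕ) (y : Baire) => ∀ (s : List ℕ) (k : ℕ),
      D a.1 (pre (fun n => y (slot 0 s n 0 [])) k) ≠ some a.2 := by
  have hl : Primrec fun p : (ℕ × ℕ) × (List ℕ × ℕ) =>
      (List.range p.2.2).map fun n => slot 0 p.2.1 n 0 [] :=
    Primrec.list_map (Primrec.list_range.comp (Primrec.snd.comp Primrec.snd))
      (primrec_slot 0 (Primrec.fst.comp (Primrec.snd.comp Primrec.fst)) Primrec.snd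
        (Primrec.const 0) (Primrec.const []))
  have hM : Computable₂ fun (p : (ℕ × ℕ) × (List ℕ × ℕ)) (L : List ℕ) =>
      !decide (D p.1.1 L = some p.1.2) :=
    Primrec.not.to_comp.comp <| (Primrec.eq (α := Option ℕ)).decide.to_comp.comp
      (hD.comp (Computable.fst.comp (Computable.fst.comp Computable.fst)) Computable.snd)
      (Computable.option_some.comp (Computable.snd.comp (Computable.fst.comp Computable.fst)))
  obtain ⟨S, hS, h⟩ := isPi01_forall_map hM hl
  refine ⟨S, hS, fun a y => Iff.trans ?_ (h a y)⟩
  simp [Prod.forall, pre, Function.comp_def]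

lemma uniformlySigma11_diag (hR : Computable₂ R) (hD : Computable₂ D) :
    UniformlySigma11 (diag R D) := by
  obtain ⟨S, hS, h⟩ := ((isPi01_lt hR hD).and (isPi01_le hR hD)).and (isPi01_ne hD)
  refine ⟨S, hS, fun e v => ?_⟩
  simp only [← h]
  constructor
  · intro hv
    choose z hz hne using hv
    choose f hf using fun s => (hz s).lt
    choose! t g hg using fun s => (hz s).le
    obtain ⟨y, hy⟩ := exists_slot_eq fun i s n m σ =>
      if i = 0 then z s n else if i = 1 then f s n m σ else if i = 2 then t s n m else g s n m σ
    refine ⟨y, ?_⟩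
    simp only [hy]
    exact ⟨⟨fun s n t σ h => hf s n t σ h, fun s n m σ hm h => hg s n m hm σ h⟩, hne⟩
  · rintro ⟨y, ⟨hlt, hle⟩, hne⟩ s
    exact ⟨fun n => y (slot 0 s n 0 []), ⟨fun n t => ⟨_, hlt s n t⟩,
      fun n m hm => ⟨_, _, fun σ h => hle s n m σ hm h⟩⟩, hne s⟩

end Definability

end HomogeneousSigma11

/-- Above any nonempty finite-or-cofinite homogeneous `Σ¹₁` set there is a
nonempty homogeneous `Σ¹₁` set not Medvedev reducible to it. -/
theorem exists_homogeneous_not_below_foc :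
    ∀ A : ℕ → Set ℕ, UniformlySigma11 A →
      (∀ n, ((A n).Nonempty ∧ (A n).Finite) ∨ (A n)ᶜ.Finite) →
      (homProd A).Nonempty →
      ∃ B : ℕ → Set ℕ, UniformlySigma11 B ∧ (homProd B).Nonempty ∧
        ¬ MedvedevLE (homProd B) (homProd A) := by
  rintro A ⟨R, hR, hA⟩ - ⟨x₀, hx₀⟩
  have hpath : ∀ n m, m ∈ A n ↔ HomogeneousSigma11.HasPath (HomogeneousSigma11.tree (R (n, m))) :=
    fun n m => by rw [HomogeneousSigma11.hasPath_tree, hA]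
  refine ⟨HomogeneousSigma11.diag R HomogeneousSigma11.readFirst,
    HomogeneousSigma11.uniformlySigma11_diag hR HomogeneousSigma11.computable₂_readFirst, ?_, ?_⟩
  · choose y hy using fun e => HomogeneousSigma11.diag_nonempty R HomogeneousSigma11.readFirst
      (HomogeneousSigma11.readFirst_pre_unique e) fun n => (hpath n _).1 (hx₀ n)
    exact ⟨y, hy⟩
  · rintro ⟨Φ, hΦ⟩
    obtain ⟨e, he⟩ := HomogeneousSigma11.exists_readFirst_eq Φ
    have hmem : ∀ n, sInf (A n) ∈ A n := fun n => Nat.sInf_mem ⟨_, hx₀ n⟩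
    obtain ⟨y, hy, hxy⟩ := hΦ (fun n => sInf (A n)) hmem
    obtain ⟨k, hk⟩ := he _ y hxy
    refine HomogeneousSigma11.exists_notMem_diag R HomogeneousSigma11.readFirst
      (fun n => (hpath n _).1 (hmem n))
      (fun n m hm h => Nat.notMem_of_lt_sInf hm ((hpath n m).2 h)) (fun z hz hu => ?_) hk (hy e)
    obtain ⟨w, -, hzw⟩ := hΦ z fun n => (hpath n _).2 (hz n)
    obtain ⟨k', hk'⟩ := he z w hzw
    rw [hu k'] at hk'
    cases hk'
end

section
/- For every nonempty Σ¹₁ closed set A ⊆ ℕ^ℕ, there exists a nonempty homogeneous Σ¹₁ set B such that B is not Medvedev reducible to A. Consequently, the Medvedev degrees of nonempty homogeneous Σ¹₁ sets and of nonempty Σ¹₁ closed sets are upward dense. -/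
open Set

theorem pre_length (x : Baire) (n : ℕ) : (pre x n).length = n := by simp [pre]

theorem pre_getElem? (x : Baire) {n i : ℕ} (h : i < n) : (pre x n)[i]? = some (x i) := by
  simp [pre, h]

theorem pre_getD (x : Baire) {n i : ℕ} (h : i < n) : (pre x n).getD i 0 = x i := by
  simp [List.getD_eq_getElem?_getD, pre_getElem? x h]

theorem pre_prefix_pre (x : Baire) {m n : ℕ} (h : m ≤ n) : pre x m <+: pre x n := by
  obtain ⟨k, rfl⟩ := Nat.exists_eq_add_of_le h
  simp [pre, List.range_add]

theorem getElem?_mono {σ τ : List ℕ} (h : σ <+: τ) {n v : ℕ} (hv : σ[n]? = some v) :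
    τ[n]? = some v := by
  obtain ⟨ρ, rfl⟩ := h
  rw [List.getElem?_append_left (List.getElem?_eq_some_iff.1 hv).1, hv]

/-! ### Closure properties of `Σ¹₁` predicates -/

/-- A predicate on a primitively coded type is (lightface) `Σ¹₁`. -/
def Sigma11Pred {α : Type*} [Primcodable α] (S : α → Prop) : Prop :=
  ∃ R : α → List ℕ → Bool, Computable₂ R ∧
    ∀ a, S a ↔ ∃ y : Baire, ∀ k, R a (pre y k) = true

/-- The first `n` entries of the `c`-th column of the sequence coded by `τ`. -/
def column (c n : ℕ) (τ : List ℕ) : List ℕ :=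
  (List.range n).map fun i => τ.getD (Nat.pair c i) 0

theorem column_pre (z : Baire) {c n t : ℕ} (h : Nat.pair c n ≤ t) :
    column c n (pre z t) = pre (fun i => z (Nat.pair c i)) n := by
  refine List.map_congr_left fun i hi => pre_getD z ?_
  exact (Nat.pair_lt_pair_right c (List.mem_range.1 hi)).trans_le h

theorem primrec_column : Primrec fun p : ℕ × ℕ × List ℕ => column p.1 p.2.1 p.2.2 := by
  refine Primrec.list_map (Primrec.list_range.comp (Primrec.fst.comp Primrec.snd)) ?_
  exact (Primrec.list_getD 0).comp
    (Primrec.snd.comp (Primrec.snd.comp Primrec.fst))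
    (Primrec₂.natPair.comp (Primrec.fst.comp Primrec.fst) Primrec.snd)

section

variable {α β : Type*} [Primcodable α] [Primcodable β]

theorem Sigma11Pred.of_computable {c : α → Bool} (hc : Computable c) :
    Sigma11Pred fun a => c a = true :=
  ⟨fun a _ => c a, hc.comp Computable.fst, fun _ => by simp⟩

theorem Sigma11Pred.comp {S : β → Prop} (hS : Sigma11Pred S) {f : α → β} (hf : Computable f) :
    Sigma11Pred fun a => S (f a) := by
  obtain ⟨R, hR, h⟩ := hS
  exact ⟨fun a => R (f a), hR.comp (hf.comp Computable.fst) Computable.snd, fun a => h (f a)⟩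

theorem Sigma11Pred.cond {S₁ S₂ : α → Prop} (h₁ : Sigma11Pred S₁) (h₂ : Sigma11Pred S₂)
    {c : α → Bool} (hc : Computable c) :
    Sigma11Pred fun a => if c a = true then S₁ a else S₂ a := by
  obtain ⟨R₁, hR₁, h₁⟩ := h₁
  obtain ⟨R₂, hR₂, h₂⟩ := h₂
  refine ⟨fun a τ => bif c a then R₁ a τ else R₂ a τ,
    Computable.cond (hc.comp Computable.fst) hR₁ hR₂, fun a => ?_⟩
  cases hca : c a
  · simpa [hca] using h₂ a
  · simpa [hca] using h₁ a

theorem Sigma11Pred.exists_forall_pre {S : α × List ℕ → Prop} (hS : Sigma11Pred S) :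
    Sigma11Pred fun a => ∃ x : Baire, ∀ n, S (a, pre x n) := by
  obtain ⟨R, hR, h⟩ := hS
  let nk : List ℕ → ℕ × ℕ := fun τ => (τ.length.unpair.1).unpair
  have hnk : Primrec nk :=
    Primrec.unpair.comp (Primrec.fst.comp (Primrec.unpair.comp Primrec.list_length))
  let guard : List ℕ → Bool := fun τ =>
    decide (Nat.pair 0 (nk τ).1 ≤ τ.length ∧ Nat.pair ((nk τ).1 + 1) (nk τ).2 ≤ τ.length)
  have hguard : Primrec guard := by
    refine PrimrecPred.decide (PrimrecPred.and ?_ ?_)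
    · exact Primrec.nat_le.comp
        (Primrec₂.natPair.comp (Primrec.const 0) (Primrec.fst.comp hnk)) Primrec.list_length
    · exact Primrec.nat_le.comp
        (Primrec₂.natPair.comp (Primrec.succ.comp (Primrec.fst.comp hnk)) (Primrec.snd.comp hnk))
        Primrec.list_length
  have hx : Primrec fun τ => column 0 (nk τ).1 τ :=
    primrec_column.comp ((Primrec.const 0).pair ((Primrec.fst.comp hnk).pair Primrec.id))
  have hy : Primrec fun τ => column ((nk τ).1 + 1) (nk τ).2 τ :=
    primrec_column.comp ((Primrec.succ.comp (Primrec.fst.comp hnk)).pair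
      ((Primrec.snd.comp hnk).pair Primrec.id))
  refine ⟨fun a τ => bif guard τ then
      R (a, column 0 (nk τ).1 τ) (column ((nk τ).1 + 1) (nk τ).2 τ) else true, ?_, fun a => ?_⟩
  · exact Computable.cond (hguard.to_comp.comp Computable.snd)
      (hR.comp (Computable.fst.pair (hx.to_comp.comp Computable.snd))
        (hy.to_comp.comp Computable.snd)) (Computable.const true)
  · constructor
    · rintro ⟨x, hx⟩
      choose y hy using fun n => (h _).1 (hx n)
      let z : Baire := fun t => Nat.casesOn t.unpair.1 (x t.unpair.2) fun n => y n t.unpair.2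
      refine ⟨z, fun t => ?_⟩
      beta_reduce
      cases hg : guard (pre z t)
      · rfl
      · have hg' := of_decide_eq_true hg
        rw [pre_length] at hg'
        rw [cond_true, column_pre z hg'.1, column_pre z hg'.2]
        simpa [z] using hy (nk (pre z t)).1 (nk (pre z t)).2
    · rintro ⟨z, hz⟩
      refine ⟨fun i => z (Nat.pair 0 i), fun n => (h _).2 ⟨fun i => z (Nat.pair (n + 1) i),
        fun k => ?_⟩⟩
      let s := Nat.pair 0 n + Nat.pair (n + 1) k
      let t := Nat.pair (Nat.pair n k) s
      have hst : s ≤ t := Nat.right_le_pair _ _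
      have h0 : Nat.pair 0 n ≤ t := (Nat.le_add_right _ _).trans hst
      have h1 : Nat.pair (n + 1) k ≤ t := (Nat.le_add_left _ _).trans hst
      have hnkt : nk (pre z t) = (n, k) := by simp [nk, pre_length, t]
      have hg : guard (pre z t) = true := by
        simp only [guard, hnkt, pre_length]
        exact decide_eq_true ⟨h0, h1⟩
      have := hz t
      beta_reduce at this
      rwa [hg, cond_true, hnkt, column_pre z h0, column_pre z h1] at this

theorem Sigma11Pred.forall_nat {S : α × ℕ → Prop} (hS : Sigma11Pred S) :
    Sigma11Pred fun a => ∀ n, S (a, n) := by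
  have := (hS.comp (f := fun p : α × List ℕ => (p.1, p.2.length))
    (Computable.fst.pair (Computable.list_length.comp Computable.snd))).exists_forall_pre
  simpa [pre_length] using this

theorem Sigma11Pred.and {S₁ S₂ : α → Prop} (h₁ : Sigma11Pred S₁) (h₂ : Sigma11Pred S₂) :
    Sigma11Pred fun a => S₁ a ∧ S₂ a := by
  have hc : Computable fun p : α × ℕ => decide (p.2 = 0) :=
    (PrimrecPred.decide (Primrec.eq.comp Primrec.snd (Primrec.const 0))).to_comp
  have := (Sigma11Pred.cond (h₁.comp Computable.fst) (h₂.comp Computable.fst) hc).forall_nat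
  convert this using 2 with a
  constructor
  · rintro ⟨ha, hb⟩ n
    split_ifs <;> assumption
  · intro h
    exact ⟨by simpa using h 0, by simpa using h 1⟩

theorem Sigma11Pred.imp_of_computable {S : α → Prop} (hS : Sigma11Pred S) {c : α → Bool}
    (hc : Computable c) : Sigma11Pred fun a => c a = true → S a := by
  have := hS.cond (Sigma11Pred.of_computable (Computable.const true)) hc
  convert this using 2 with a
  split_ifs with h <;> simp [h]

theorem Sigma11Pred.exists_nat {S : α × ℕ → Prop} (hS : Sigma11Pred S) :
    Sigma11Pred fun a => ∃ n, S (a, n) := by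
  have hc : Computable fun p : α × List ℕ => decide (p.2.length = 1) :=
    (PrimrecPred.decide (Primrec.eq.comp (Primrec.list_length.comp Primrec.snd)
      (Primrec.const 1))).to_comp
  have hf : Computable fun p : α × List ℕ => (p.1, p.2.getD 0 0) :=
    Computable.fst.pair
      (((Primrec.list_getD 0).comp Primrec.snd (Primrec.const 0)).to_comp)
  have := ((hS.comp hf).imp_of_computable hc).exists_forall_pre
  convert this using 2 with a
  constructor
  · rintro ⟨n, hn⟩
    refine ⟨fun _ => n, fun k hk => ?_⟩
    have hk' := of_decide_eq_true hk
    rw [pre_length] at hk'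
    subst hk'
    simpa [pre] using hn
  · rintro ⟨x, hx⟩
    exact ⟨x 0, by simpa [pre] using hx 1⟩

end

/-! ### Medvedev reducibility -/

theorem TuringFunctional.Eval.exists_pre_prefix_apply {Φ : TuringFunctional} {x y : Baire}
    (h : Φ.Eval x y) (m : ℕ) : ∃ M, pre y m <+: Φ.φ (pre x M) := by
  choose f hf using h
  let M := (Finset.range m).sup f
  refine ⟨M, List.prefix_iff_getElem?.2 fun i hi => ?_⟩
  rw [pre_length] at hi
  have hle : f i ≤ M := Finset.le_sup (Finset.mem_range.2 hi)
  rw [getElem?_mono (Φ.mono _ _ (pre_prefix_pre x hle)) (hf i)]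
  simp [pre]

theorem MedvedevLE.trans {P Q R : Set Baire} (h₁ : MedvedevLE P Q) (h₂ : MedvedevLE Q R) :
    MedvedevLE P R := by
  obtain ⟨Φ, hΦ⟩ := h₁
  obtain ⟨Ψ, hΨ⟩ := h₂
  refine ⟨⟨fun σ => Φ.φ (Ψ.φ σ), Φ.computable.comp Ψ.computable,
    fun σ τ h => Φ.mono _ _ (Ψ.mono _ _ h)⟩, fun x hx => ?_⟩
  obtain ⟨y, hy, hxy⟩ := hΨ x hx
  obtain ⟨z, hz, hyz⟩ := hΦ y hy
  refine ⟨z, hz, fun n => ?_⟩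
  obtain ⟨m, hm⟩ := hyz n
  obtain ⟨M, hM⟩ := hxy.exists_pre_prefix_apply m
  exact ⟨M, getElem?_mono (Φ.mono _ _ hM) hm⟩

/-- The entries of `σ` at the positions `2 * k + i`, for `k` below half the length of `σ`. -/
def half (i : ℕ) (σ : List ℕ) : List ℕ :=
  (List.range (σ.length / 2)).map fun k => σ.getD (2 * k + i) 0

theorem primrec_half (i : ℕ) : Primrec (half i) := by
  refine Primrec.list_map (Primrec.list_range.comp
    (Primrec.nat_div.comp Primrec.list_length (Primrec.const 2))) ?_
  exact (Primrec.list_getD 0).comp Primrec.fst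
    (Primrec.nat_add.comp (Primrec.nat_mul.comp (Primrec.const 2) Primrec.snd)
      (Primrec.const i))

theorem half_mono {i : ℕ} (hi : i < 2) {σ τ : List ℕ} (h : σ <+: τ) : half i σ <+: half i τ := by
  have hl := h.length_le
  rw [List.prefix_iff_getElem?]
  intro k hk
  have hk' : k < σ.length / 2 := by simpa [half] using hk
  have h1 : k < τ.length / 2 := by omega
  have h2 : 2 * k + i < σ.length := by omega
  have := getElem?_mono h (List.getElem?_eq_getElem h2)
  simp [half, h1, this, h2]

theorem half_pre {i : ℕ} (hi : i < 2) (x : Baire) (n : ℕ) :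
    half i (pre x n) = pre (fun k => x (2 * k + i)) (n / 2) := by
  rw [half, pre_length]
  refine List.map_congr_left fun k hk => pre_getD x ?_
  have := List.mem_range.1 hk
  omega

theorem medvedevLE_of_half {i : ℕ} (hi : i < 2) {P Q : Set Baire}
    (h : ∀ x ∈ Q, (fun k => x (2 * k + i)) ∈ P) : MedvedevLE P Q := by
  refine ⟨⟨half i, (primrec_half i).to_comp, fun _ _ => half_mono hi⟩,
    fun x hx => ⟨_, h x hx, fun n => ⟨2 * (n + 1), ?_⟩⟩⟩
  change (half i (pre x (2 * (n + 1))))[n]? = _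
  rw [half_pre hi, pre_getElem? _ (by omega)]

/-- If `R` projects to `P` on even and to `Q` on odd coordinates and `Q` does not reduce to `P`,
then `P` is strictly below `R`. -/
theorem medvedevLT_of_half {P Q R : Set Baire} (hP : ∀ x ∈ R, (fun k => x (2 * k)) ∈ P)
    (hQ : ∀ x ∈ R, (fun k => x (2 * k + 1)) ∈ Q) (h : ¬ MedvedevLE Q P) : MedvedevLT P R :=
  ⟨medvedevLE_of_half (i := 0) (by norm_num) hP, fun hR =>
    h ((medvedevLE_of_half (i := 1) (by norm_num) hQ).trans hR)⟩

/-- The sequence with even part `x` and odd part `y`. -/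
def interleave (x y : Baire) : Baire := fun n => if n % 2 = 0 then x (n / 2) else y (n / 2)

theorem interleave_even (x y : Baire) (k : ℕ) : interleave x y (2 * k) = x k := by
  simp [interleave]

theorem interleave_odd (x y : Baire) (k : ℕ) : interleave x y (2 * k + 1) = y k := by
  have h1 : (2 * k + 1) % 2 = 1 := by omega
  have h2 : (2 * k + 1) / 2 = k := by omega
  simp [interleave, h1, h2]

/-! ### The tree of a homogeneous set -/

/-- The tree of finite sequences all of whose entries lie in the corresponding `A n`. -/
def homTree (A : ℕ → Set ℕ) : Set (List ℕ) := {σ | ∀ i, i < σ.length → σ.getD i 0 ∈ A i}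

theorem isTree_homTree (A : ℕ → Set ℕ) : IsTree (homTree A) := by
  rintro σ hσ τ ⟨ρ, rfl⟩ i hi
  have := hσ i (by simp; omega)
  rwa [List.getD_append _ _ _ _ hi] at this

theorem paths_homTree (A : ℕ → Set ℕ) : paths (homTree A) = homProd A := by
  ext x
  constructor
  · intro h n
    have := h (n + 1) n (by simp [pre_length])
    rwa [pre_getD x n.lt_succ_self] at this
  · intro h n i hi
    rw [pre_length] at hi
    rw [pre_getD x hi]
    exact h i

theorem UniformlySigma11.sigma11Pred {A : ℕ → Set ℕ} (hA : UniformlySigma11 A) :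
    Sigma11Pred fun p : ℕ × ℕ => p.2 ∈ A p.1 := by
  obtain ⟨R, hR, h⟩ := hA
  exact ⟨R, hR, fun p => h p.1 p.2⟩

theorem Sigma11Pred.uniformlySigma11 {A : ℕ → Set ℕ}
    (hA : Sigma11Pred fun p : ℕ × ℕ => p.2 ∈ A p.1) : UniformlySigma11 A := by
  obtain ⟨R, hR, h⟩ := hA
  exact ⟨R, hR, fun n m => h (n, m)⟩

theorem sigma11List_homTree {A : ℕ → Set ℕ} (hA : UniformlySigma11 A) :
    Sigma11List (homTree A) := by
  have hf : Primrec fun p : List ℕ × ℕ => (p.2, p.1.getD p.2 0) :=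
    Primrec.snd.pair ((Primrec.list_getD 0).comp Primrec.fst Primrec.snd)
  have hc : Primrec fun p : List ℕ × ℕ => decide (p.2 < p.1.length) :=
    PrimrecPred.decide (Primrec.nat_lt.comp Primrec.snd (Primrec.list_length.comp Primrec.fst))
  change Sigma11Pred fun σ : List ℕ => ∀ i, i < σ.length → σ.getD i 0 ∈ A i
  simpa only [decide_eq_true_eq] using
    ((hA.sigma11Pred.comp hf.to_comp).imp_of_computable hc.to_comp).forall_nat

/-! ### Diagonalization -/

/-- The value at `e` that the `e`-th program outputs within `s` steps on input `σ`, if any. -/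
def diagValue (e s : ℕ) (σ : List ℕ) : Option ℕ :=
  (((Denumerable.ofNat Nat.Partrec.Code e).evaln s (Encodable.encode σ)).bind
    fun n => (Encodable.decode n : Option (List ℕ))).bind fun τ => τ[e]?

theorem primrec_diagValue :
    Primrec fun p : ℕ × ℕ × List ℕ => diagValue p.1 p.2.1 p.2.2 := by
  have h1 : Primrec fun p : ℕ × ℕ × List ℕ =>
      (Denumerable.ofNat Nat.Partrec.Code p.1).evaln p.2.1 (Encodable.encode p.2.2) :=
    Nat.Partrec.Code.primrec_evaln.comp
      (((Primrec.fst.comp Primrec.snd).pair ((Primrec.ofNat _).comp Primrec.fst)).pair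
        (Primrec.encode.comp (Primrec.snd.comp Primrec.snd)))
  refine Primrec.option_bind (Primrec.option_bind h1 (Primrec.decode.comp Primrec.snd)) ?_
  exact Primrec.list_getElem?.comp Primrec.snd (Primrec.fst.comp Primrec.fst)

theorem exists_diagValue (φ : List ℕ → List ℕ) (hφ : Computable φ) :
    ∃ e, (∀ s σ v, diagValue e s σ = some v → (φ σ)[e]? = some v) ∧
      ∀ σ v, (φ σ)[e]? = some v → ∃ s, diagValue e s σ = some v := by
  obtain ⟨c, hc⟩ := Nat.Partrec.Code.exists_code.1 hφ
  have hev : ∀ σ, c.eval (Encodable.encode σ) = Part.some (Encodable.encode (φ σ)) := by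
    intro σ
    simp [hc]
  refine ⟨Encodable.encode c, fun s σ v h => ?_, fun σ v h => ?_⟩
  · rw [diagValue, Denumerable.ofNat_encode] at h
    obtain ⟨τ, hτ, h⟩ := Option.bind_eq_some_iff.1 h
    obtain ⟨n, hn, hτ⟩ := Option.bind_eq_some_iff.1 hτ
    have := Nat.Partrec.Code.evaln_sound (Option.mem_def.2 hn)
    rw [hev, Part.mem_some_iff] at this
    subst this
    rw [Encodable.encodek, Option.some_inj] at hτ
    rwa [hτ]
  · obtain ⟨s, hs⟩ := Nat.Partrec.Code.evaln_complete.1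
      (show Encodable.encode (φ σ) ∈ c.eval (Encodable.encode σ) by simp [hev])
    refine ⟨s, ?_⟩
    rw [diagValue, Denumerable.ofNat_encode, Option.mem_def.1 hs, Option.bind_some,
      Encodable.encodek, Option.bind_some, h]

/-- The witness `b` asserts either that program `e` never produces a value at `e` (if `b = 0`), or
that it produces the value `v` on a prefix and in a number of steps coded by `b - 1`. -/
def DiagConsistent (b e v s : ℕ) (σ : List ℕ) : Prop :=
  (b ≠ 0 ∨ diagValue e s σ = none) ∧
    (b ≠ Nat.pair σ.length s + 1 ∨ diagValue e s σ = some v)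

/-- The possible values at `e` of the `e`-th program on elements of `[T]`, where a computation
without a value at `e` counts as producing every value. -/
def diagValues (T : Set (List ℕ)) (e : ℕ) : Set ℕ :=
  {v | ∃ b, ∃ x : Baire, ∀ n, pre x n ∈ T ∧ ∀ s, DiagConsistent b e v s (pre x n)}

theorem sigma11Pred_diagConsistent :
    Sigma11Pred fun p : ((((ℕ × ℕ) × ℕ) × List ℕ) × ℕ) =>
      DiagConsistent p.1.1.2 p.1.1.1.1 p.1.1.1.2 p.2 p.1.2 := by
  have he : Primrec fun p : ((((ℕ × ℕ) × ℕ) × List ℕ) × ℕ) => p.1.1.1.1 :=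
    Primrec.fst.comp (Primrec.fst.comp (Primrec.fst.comp Primrec.fst))
  have hv : Primrec fun p : ((((ℕ × ℕ) × ℕ) × List ℕ) × ℕ) => p.1.1.1.2 :=
    Primrec.snd.comp (Primrec.fst.comp (Primrec.fst.comp Primrec.fst))
  have hb : Primrec fun p : ((((ℕ × ℕ) × ℕ) × List ℕ) × ℕ) => p.1.1.2 :=
    Primrec.snd.comp (Primrec.fst.comp Primrec.fst)
  have hσ : Primrec fun p : ((((ℕ × ℕ) × ℕ) × List ℕ) × ℕ) => p.1.2 :=
    Primrec.snd.comp Primrec.fst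
  have hs : Primrec fun p : ((((ℕ × ℕ) × ℕ) × List ℕ) × ℕ) => p.2 := Primrec.snd
  have hd := primrec_diagValue.comp (he.pair (hs.pair hσ))
  have hP : PrimrecPred fun p : ((((ℕ × ℕ) × ℕ) × List ℕ) × ℕ) =>
      DiagConsistent p.1.1.2 p.1.1.1.1 p.1.1.1.2 p.2 p.1.2 := by
    refine PrimrecPred.and (PrimrecPred.or (PrimrecPred.not ?_) ?_)
      (PrimrecPred.or (PrimrecPred.not ?_) ?_)
    · exact Primrec.eq.comp hb (Primrec.const 0)
    · exact Primrec.eq.comp hd (Primrec.const none)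
    · exact Primrec.eq.comp hb (Primrec.succ.comp
        (Primrec₂.natPair.comp (Primrec.list_length.comp hσ) hs))
    · exact Primrec.eq.comp hd (Primrec.option_some.comp hv)
  classical
  simpa using Sigma11Pred.of_computable hP.decide.to_comp

theorem sigma11Pred_diagValues {T : Set (List ℕ)} (hT : Sigma11List T) :
    Sigma11Pred fun p : ℕ × ℕ => p.2 ∈ diagValues T p.1 := by
  have hT' : Sigma11Pred fun σ => σ ∈ T := hT
  have := ((hT'.comp (α := ((ℕ × ℕ) × ℕ) × List ℕ) Computable.snd).and
    sigma11Pred_diagConsistent.forall_nat).exists_forall_pre.exists_nat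
  exact this

theorem diagValues_nonempty {T : Set (List ℕ)} (hT : (paths T).Nonempty) (e : ℕ) :
    (diagValues T e).Nonempty := by
  obtain ⟨x, hx⟩ := hT
  by_cases h : ∃ n s v, diagValue e s (pre x n) = some v
  · obtain ⟨n, s, v, h⟩ := h
    refine ⟨v, Nat.pair n s + 1, x, fun m => ⟨hx m, fun t => ⟨Or.inl (Nat.succ_ne_zero _), ?_⟩⟩⟩
    rw [pre_length]
    by_cases hp : Nat.pair n s = Nat.pair m t
    · obtain ⟨rfl, rfl⟩ := Nat.pair_eq_pair.1 hp
      exact Or.inr h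
    · exact Or.inl fun h' => hp (Nat.succ_injective h')
  · push Not at h
    exact ⟨0, 0, x, fun m => ⟨hx m, fun t =>
      ⟨Or.inr (Option.eq_none_iff_forall_ne_some.2 (h m t)), Or.inl (Nat.succ_ne_zero _).symm⟩⟩⟩

theorem exists_eval_of_mem_diagValues (Φ : TuringFunctional) :
    ∃ e, ∀ (T : Set (List ℕ)), ∀ v ∈ diagValues T e, ∃ x ∈ paths T, ∀ y, Φ.Eval x y → y e = v := by
  obtain ⟨e, hsound, hcomplete⟩ := exists_diagValue Φ.φ Φ.computable
  refine ⟨e, fun T v hv => ?_⟩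
  obtain ⟨b, x, hx⟩ := hv
  refine ⟨x, fun n => (hx n).1, fun y hy => ?_⟩
  obtain ⟨m, hm⟩ := hy e
  obtain ⟨s, hs⟩ := hcomplete _ _ hm
  rcases b with _ | b
  · have := ((hx m).2 s).1
    simp [hs] at this
  · have h := ((hx b.unpair.1).2 b.unpair.2).2
    rw [pre_length, Nat.pair_unpair] at h
    have hv := hsound _ _ _ (h.resolve_left (not_not.2 rfl))
    have h1 := getElem?_mono (Φ.mono _ _ (pre_prefix_pre x (le_max_left m b.unpair.1))) hm
    have h2 := getElem?_mono (Φ.mono _ _ (pre_prefix_pre x (le_max_right m b.unpair.1))) hv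
    exact Option.some_inj.1 (h1.symm.trans h2)

theorem exists_homogeneous_not_medvedevLE {T : Set (List ℕ)} (hT : Sigma11List T)
    (hne : (paths T).Nonempty) :
    ∃ B : ℕ → Set ℕ, UniformlySigma11 B ∧ (homProd B).Nonempty ∧
      ¬ MedvedevLE (homProd B) (paths T) := by
  refine ⟨fun e => {m | ∃ k, k < m ∧ k ∈ diagValues T e}, ?_, ?_, ?_⟩
  · have hf : Computable fun p : (ℕ × ℕ) × ℕ => (p.1.1, p.2) :=
      (Computable.fst.comp Computable.fst).pair Computable.snd
    have hc : Primrec fun p : (ℕ × ℕ) × ℕ => decide (p.2 < p.1.2) :=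
      PrimrecPred.decide (Primrec.nat_lt.comp Primrec.snd (Primrec.snd.comp Primrec.fst))
    refine Sigma11Pred.uniformlySigma11 ?_
    simpa using ((Sigma11Pred.of_computable hc.to_comp).and
      ((sigma11Pred_diagValues hT).comp hf)).exists_nat
  · choose v hv using diagValues_nonempty hne
    exact ⟨fun e => v e + 1, fun e => ⟨v e, Nat.lt_succ_self _, hv e⟩⟩
  · rintro ⟨Φ, hΦ⟩
    obtain ⟨e, he⟩ := exists_eval_of_mem_diagValues Φ
    have hmem := Nat.sInf_mem (diagValues_nonempty hne e)
    obtain ⟨x, hx, hxv⟩ := he T _ hmem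
    obtain ⟨y, hy, hxy⟩ := hΦ x hx
    obtain ⟨k, hk, hkV⟩ := hy e
    rw [hxv y hxy] at hk
    exact Nat.notMem_of_lt_sInf hk hkV

theorem homogeneous_upward_dense {A : ℕ → Set ℕ} (hA : UniformlySigma11 A)
    (hne : (homProd A).Nonempty) :
    ∃ B : ℕ → Set ℕ, UniformlySigma11 B ∧ (homProd B).Nonempty ∧
      MedvedevLT (homProd A) (homProd B) := by
  obtain ⟨C, hC, ⟨y, hy⟩, hCA⟩ := exists_homogeneous_not_medvedevLE (sigma11List_homTree hA)
    (by rwa [paths_homTree])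
  rw [paths_homTree] at hCA
  obtain ⟨x, hx⟩ := hne
  refine ⟨fun n => if n % 2 = 0 then A (n / 2) else C (n / 2), ?_,
    ⟨interleave x y, fun n => ?_⟩, medvedevLT_of_half (Q := homProd C) ?_ ?_ hCA⟩
  · have hf : Primrec fun p : ℕ × ℕ => (p.1 / 2, p.2) :=
      (Primrec.nat_div.comp Primrec.fst (Primrec.const 2)).pair Primrec.snd
    have hc : Primrec fun p : ℕ × ℕ => decide (p.1 % 2 = 0) :=
      PrimrecPred.decide (Primrec.eq.comp
        (Primrec.nat_mod.comp Primrec.fst (Primrec.const 2)) (Primrec.const 0))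
    refine Sigma11Pred.uniformlySigma11 ?_
    have := (hA.sigma11Pred.comp hf.to_comp).cond (hC.sigma11Pred.comp hf.to_comp) hc.to_comp
    convert this using 2 with p
    by_cases h : p.1 % 2 = 0 <;> simp [h]
  · by_cases h : n % 2 = 0
    · simpa [interleave, h] using hx (n / 2)
    · simpa [interleave, h] using hy (n / 2)
  · intro z hz k
    simpa using hz (2 * k)
  · intro z hz k
    have h1 : (2 * k + 1) % 2 = 1 := by omega
    have h2 : (2 * k + 1) / 2 = k := by omega
    simpa [h1, h2] using hz (2 * k + 1)

theorem closed_upward_dense {T : Set (List ℕ)} (hT : IsTree T) (hT₁ : Sigma11List T)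
    (hne : (paths T).Nonempty) :
    ∃ T' : Set (List ℕ), IsTree T' ∧ Sigma11List T' ∧ (paths T').Nonempty ∧
      MedvedevLT (paths T) (paths T') := by
  obtain ⟨C, hC, ⟨y, hy⟩, hCT⟩ := exists_homogeneous_not_medvedevLE hT₁ hne
  rw [← paths_homTree] at hy hCT
  obtain ⟨x, hx⟩ := hne
  have h0 : 0 < 2 := by norm_num
  have h1 : 1 < 2 := by norm_num
  refine ⟨{σ | half 0 σ ∈ T ∧ half 1 σ ∈ homTree C}, ?_, ?_,
    ⟨interleave x y, fun n => ⟨?_, ?_⟩⟩, medvedevLT_of_half (Q := paths (homTree C)) ?_ ?_ hCT⟩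
  · exact fun σ hσ τ hτ => ⟨hT _ hσ.1 _ (half_mono h0 hτ),
      isTree_homTree C _ hσ.2 _ (half_mono h1 hτ)⟩
  · exact (Sigma11Pred.comp (S := fun σ => σ ∈ T) hT₁ (primrec_half 0).to_comp).and
      (Sigma11Pred.comp (S := fun σ => σ ∈ homTree C) (sigma11List_homTree hC)
        (primrec_half 1).to_comp)
  · rw [half_pre h0]
    simpa [interleave_even] using hx (n / 2)
  · rw [half_pre h1]
    simpa [interleave_odd] using hy (n / 2)
  · intro z hz n
    simpa [half_pre h0] using (hz (2 * n)).1
  · intro z hz n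
    simpa [half_pre h1] using (hz (2 * n)).2

/-- For every nonempty `Σ¹₁` closed set there is a nonempty homogeneous `Σ¹₁`
set not Medvedev reducible to it; consequently the Medvedev degrees of nonempty
homogeneous `Σ¹₁` sets, and of nonempty `Σ¹₁` closed sets, are upward dense. -/
theorem homogeneous_not_below_closed_and_upward_density :
    (∀ T : Set (List ℕ), IsTree T → Sigma11List T → (paths T).Nonempty →
      ∃ B : ℕ → Set ℕ, UniformlySigma11 B ∧ (homProd B).Nonempty ∧
        ¬ MedvedevLE (homProd B) (paths T)) ∧
    (∀ A : ℕ → Set ℕ, UniformlySigma11 A → (homProd A).Nonempty →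
      ∃ B : ℕ → Set ℕ, UniformlySigma11 B ∧ (homProd B).Nonempty ∧
        MedvedevLT (homProd A) (homProd B)) ∧
    (∀ T : Set (List ℕ), IsTree T → Sigma11List T → (paths T).Nonempty →
      ∃ T' : Set (List ℕ), IsTree T' ∧ Sigma11List T' ∧ (paths T').Nonempty ∧
        MedvedevLT (paths T) (paths T')) :=
  ⟨fun _ _ hT₁ hne => exists_homogeneous_not_medvedevLE hT₁ hne,
    fun _ hA hne => homogeneous_upward_dense hA hne,
    fun _ hT hT₁ hne => closed_upward_dense hT hT₁ hne⟩
end
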